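/- arXiv:2010.01341 — 2 statements merged into one kernel-verified Lean document; each statement's English description precedes it below -/
import Mathlib

section
/- Let n ≥ 1 and 1 < p < ∞. There exists β > 0 such that the operator g ↦ ∫_{ℝⁿ} sup_{t>0} |t ∂_t T_t^𝒜(x,y)| χ_{N_β^c}(x,y) g(y) dy is bounded from L^p(ℝⁿ, γ₋₁) into itself: there exists C > 0 such that for every measurable g : ℝⁿ → [0,∞], ∫_{ℝⁿ} (∫_{ℝⁿ} sup_{t>0} |t ∂_t T_t^𝒜(x,y)| χ_{N_β^c}(x,y) g(y) dy)^p γ₋₁(x) dx ≤ C ∫_{ℝⁿ} g(y)^p γ₋₁(y) dy. -/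
open MeasureTheory Real
open scoped ENNReal

/-- The inverse Gaussian measure `γ₋₁` on `ℝⁿ`, with density `π^{n/2} e^{|x|²}`
with respect to Lebesgue measure. -/
noncomputable def gammaM1 (n : ℕ) : Measure (EuclideanSpace ℝ (Fin n)) :=
  volume.withDensity fun x => ENNReal.ofReal (Real.pi ^ ((n : ℝ) / 2) * Real.exp (‖x‖ ^ 2))

/-- The local region `N_β = {(x,y) : |x-y| ≤ β min(1, 1/|x|)}`. -/
def localNb (n : ℕ) (β : ℝ) :
    Set (EuclideanSpace ℝ (Fin n) × EuclideanSpace ℝ (Fin n)) :=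
  {p | ‖p.1 - p.2‖ ≤ β ∧ ‖p.1 - p.2‖ * ‖p.1‖ ≤ β}

/-- The kernel `T_t^𝒜(x,y)` of the semigroup generated by `-𝒜`, where
`𝒜 = -½Δ - x·∇` on `ℝⁿ`. -/
noncomputable def heatKerA (n : ℕ) (t : ℝ) (x y : EuclideanSpace ℝ (Fin n)) : ℝ :=
  Real.exp (-(n : ℝ) * t) * Real.pi ^ (-(n : ℝ) / 2) *
    (1 - Real.exp (-2 * t)) ^ (-(n : ℝ) / 2) *
    Real.exp (-‖x - Real.exp (-t) • y‖ ^ 2 / (1 - Real.exp (-2 * t)))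

/-- The heat kernel is `e^{-nt} π^{-n/2} s^{-n/2} e^{-D}`; its derivative is controlled by
`s^{-n/2} (1+D)(1+|x|√s) e^{-D}`, where `s = 1 - e^{-2t}` and `D = |x - e^{-t}y|²/s`. -/
theorem mul_abs_deriv_heatKerA_le {n : ℕ} (hn : 1 ≤ n) {t : ℝ} (ht : 0 < t)
    (x y : EuclideanSpace ℝ (Fin n)) {r s D : ℝ} (hr : r = Real.exp (-t)) (hs : s = 1 - r ^ 2)
    (hD : D = ‖x - r • y‖ ^ 2 / s) :
    t * |deriv (fun u => heatKerA n u x y) t| ≤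
      (n + 2) * ((√s)⁻¹ ^ n * ((1 + D) * (1 + ‖x‖ * √s) * Real.exp (-D))) := by
  have hr0 : 0 < r := hr ▸ Real.exp_pos _
  have hr1 : r < 1 := by rw [hr, Real.exp_lt_one_iff]; linarith
  have hs0 : 0 < s := by rw [hs]; nlinarith
  have hs1 : s ≤ 1 := by rw [hs]; nlinarith
  have hr2 : Real.exp (-2 * t) = r ^ 2 := by rw [hr, ← Real.exp_nat_mul]; congr 1; push_cast; ring
  have hes : 1 - Real.exp (-2 * t) = s := by rw [hr2, hs]
  have htr : t * r ≤ s / 2 := by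
    have h1 : t ≤ Real.sinh t := Real.self_le_sinh_iff.2 ht.le
    rw [Real.sinh_eq, ← hr] at h1
    have h2 : Real.exp t * r = 1 := by rw [hr, ← Real.exp_add]; simp
    rw [hs]; nlinarith
  have htrn : t * r ^ n ≤ s / 2 := by
    obtain ⟨m, rfl⟩ : ∃ m, n = m + 1 := ⟨n - 1, by omega⟩
    have : r ^ m ≤ 1 := pow_le_one₀ hr0.le hr1.le
    have h3 : 0 ≤ t * r := by positivity
    calc t * r ^ (m + 1) = (t * r) * r ^ m := by ring
      _ ≤ t * r * 1 := by gcongr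
      _ ≤ s / 2 := by linarith
  set b : ℝ := inner ℝ x y
  have hN : ∀ u : ℝ, ‖x - Real.exp (-u) • y‖ ^ 2 =
      ‖x‖ ^ 2 - 2 * (Real.exp (-u) * b) + Real.exp (-2 * u) * ‖y‖ ^ 2 := by
    intro u
    rw [norm_sub_sq_real, inner_smul_right, norm_smul, mul_pow, Real.norm_eq_abs, sq_abs,
      ← Real.exp_nat_mul]
    norm_num [b]
  set N := ‖x - r • y‖ with hNdef
  have hexp1 : HasDerivAt (fun u : ℝ => Real.exp (-u)) (-r) t := by
    have := (hasDerivAt_neg t).exp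
    rw [hr]; simpa using this
  have hexp2 : HasDerivAt (fun u : ℝ => Real.exp (-2 * u)) (-2 * r ^ 2) t := by
    have := ((hasDerivAt_id t).const_mul (-2 : ℝ)).exp
    simp only [id, mul_one] at this
    rw [hr2] at this
    convert this using 1; ring
  have hexpn : HasDerivAt (fun u : ℝ => Real.exp (-(n : ℝ) * u)) (-(n : ℝ) * r ^ n) t := by
    have := ((hasDerivAt_id t).const_mul (-(n : ℝ))).exp
    simp only [id, mul_one] at this
    convert this using 1
    rw [hr, ← Real.exp_nat_mul, mul_comm]; congr 2; simp
  have hS : HasDerivAt (fun u : ℝ => 1 - Real.exp (-2 * u)) (2 * r ^ 2) t := by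
    exact (hexp2.const_sub 1).congr_deriv (by ring)
  have hNd : HasDerivAt (fun u : ℝ => ‖x - Real.exp (-u) • y‖ ^ 2)
      (2 * r * b - 2 * r ^ 2 * ‖y‖ ^ 2) t := by
    simp_rw [hN]
    exact ((((hexp1.mul_const b).const_mul 2).const_sub (‖x‖ ^ 2)).add
      (hexp2.mul_const (‖y‖ ^ 2))).congr_deriv (by ring)
  have hrpow := hS.rpow_const (p := -(n : ℝ) / 2) (Or.inl (by rw [hes]; exact hs0.ne'))
  have hE := ((hNd.neg).div hS (by rw [hes]; exact hs0.ne')).exp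
  set P := Real.pi ^ (-(n : ℝ) / 2) with hP
  have hP0 : 0 < P := by positivity
  have hP1 : P ≤ 1 := Real.rpow_le_one_of_one_le_of_nonpos (by linarith [Real.pi_gt_three])
    (by have : (0 : ℝ) ≤ n := n.cast_nonneg
        linarith)
  set S := s ^ (-(n : ℝ) / 2) with hSdef
  have hS0 : 0 < S := by positivity
  have hSr : (√s)⁻¹ ^ n = S := by
    rw [hSdef, Real.sqrt_eq_rpow, ← Real.rpow_neg hs0.le, ← Real.rpow_mul_natCast hs0.le]
    congr 1; ring
  set w := b - r * ‖y‖ ^ 2 with hw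
  have hwle : |w| ≤ ‖y‖ * N := by
    have : w = inner ℝ y (x - r • y) := by
      rw [inner_sub_right, inner_smul_right, real_inner_self_eq_norm_sq, real_inner_comm]
    rw [this]; exact abs_real_inner_le_norm _ _
  have hD0 : 0 ≤ D := by rw [hD]; positivity
  have hderiv : HasDerivAt (fun u => heatKerA n u x y)
      (P * S * Real.exp (-D) * (r ^ n *
        (-n - n * r ^ 2 / s - 2 * r * w / s + 2 * r ^ 2 * D / s))) t := by
    have hF := (((hexpn.mul_const P).mul hrpow).mul hE)
    refine hF.congr_deriv ?_
    simp only [Pi.div_apply, Pi.neg_apply, Pi.mul_apply, hes]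
    rw [← hr, ← hNdef, Real.rpow_sub_one hs0.ne', ← hSdef, neg_div s (N ^ 2), ← hD]
    have h1 : Real.exp (-(n : ℝ) * t) = r ^ n := by
      rw [hr, ← Real.exp_nat_mul]; congr 1; ring
    have h2 : N ^ 2 = D * s := by rw [hD]; field_simp
    rw [h1, h2, hw]
    field_simp
    ring
  rw [hderiv.deriv, hSr, abs_mul, abs_of_pos (by positivity : 0 < P * S * Real.exp (-D)), abs_mul,
    abs_of_pos (by positivity : 0 < r ^ n)]
  have hNs : N = √s * √D := by
    rw [← Real.sqrt_mul hs0.le, hD, mul_div_cancel₀ _ hs0.ne', Real.sqrt_sq (norm_nonneg _)]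
  have hsq : √D ≤ 1 + D := by
    nlinarith [Real.sq_sqrt hD0, sq_nonneg (√D - 1), Real.sqrt_nonneg D]
  have hsq1 : √s ≤ 1 := Real.sqrt_le_one.2 hs1
  have hry : r * ‖y‖ ≤ ‖x‖ + N := by
    have := norm_sub_norm_le (r • y) x
    rw [norm_smul, Real.norm_of_nonneg hr0.le, norm_sub_rev, ← hNdef] at this
    linarith
  have hN0 : 0 ≤ N := norm_nonneg _
  have hNN : N * N ≤ D := by
    have : N * N = s * D := by rw [hD]; field_simp
    rw [this]; exact mul_le_of_le_one_left hD0 hs1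
  have hW : |-n - n * r ^ 2 / s - 2 * r * w / s + 2 * r ^ 2 * D / s| ≤
      (2 * n + 2 * (r * ‖y‖) * N + 2 * D) / s := by
    rw [le_div_iff₀ hs0, ← abs_of_pos hs0, ← abs_mul, abs_of_pos hs0]
    have h1 : (-n - n * r ^ 2 / s - 2 * r * w / s + 2 * r ^ 2 * D / s) * s
        = -(n * s) - n * r ^ 2 - 2 * (r * w) + 2 * (r ^ 2 * D) := by field_simp
    have h2 : |r * w| ≤ r * ‖y‖ * N := by
      rw [abs_mul, abs_of_pos hr0, mul_assoc]; gcongr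
    have h3 : (n : ℝ) * s + n * r ^ 2 = n := by rw [hs]; ring
    have h4 : r ^ 2 * D ≤ D := mul_le_of_le_one_left hD0 (by nlinarith)
    have h5 : 0 ≤ r ^ 2 * D := by positivity
    have h6 : (0 : ℝ) ≤ n := n.cast_nonneg
    rw [h1]
    obtain ⟨h7, h8⟩ := abs_le.1 h2
    exact abs_le.2 ⟨by linarith, by linarith⟩
  have hmain : t * r ^ n * |-n - n * r ^ 2 / s - 2 * r * w / s + 2 * r ^ 2 * D / s| ≤
      (n + 2) * ((1 + D) * (1 + ‖x‖ * √s)) := by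
    calc _ ≤ s / 2 * ((2 * n + 2 * (r * ‖y‖) * N + 2 * D) / s) := by gcongr
      _ = n + (r * ‖y‖) * N + D := by field_simp
      _ ≤ n + (‖x‖ + N) * N + D := by gcongr
      _ = n + ‖x‖ * √s * √D + N * N + D := by rw [add_mul, mul_assoc ‖x‖, ← hNs]; ring
      _ ≤ n + ‖x‖ * √s * (1 + D) + D + D := by gcongr
      _ ≤ _ := by
        have h1 : 0 ≤ ‖x‖ * √s := by positivity
        have h2 : (0 : ℝ) ≤ n := n.cast_nonneg
        have h3 : 0 ≤ n * D := by positivity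
        have h4 : 0 ≤ (n + 1) * (‖x‖ * √s * (1 + D)) := by positivity
        nlinarith
  calc _ = P * (S * Real.exp (-D)) *
        (t * r ^ n * |-n - n * r ^ 2 / s - 2 * r * w / s + 2 * r ^ 2 * D / s|) := by ring
    _ ≤ 1 * (S * Real.exp (-D)) * ((n + 2) * ((1 + D) * (1 + ‖x‖ * √s))) := by gcongr
    _ = _ := by ring

/-- Polynomial growth is dominated by exponential growth. -/
theorem exists_two_add_pow_le_exp (m : ℕ) {c : ℝ} (hc : 0 < c) :
    ∃ C : ℝ, 0 < C ∧ ∀ u : ℝ, 0 ≤ u → (2 + u) ^ m ≤ C * Real.exp (c * u) := by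
  refine ⟨m.factorial * Real.exp (2 * c) / c ^ m, by positivity, fun u hu => ?_⟩
  have h := Real.pow_div_factorial_le_exp (c * (2 + u)) (by positivity) m
  rw [div_le_iff₀ (by positivity), mul_pow, mul_add, Real.exp_add] at h
  rw [div_mul_eq_mul_div, le_div_iff₀ (by positivity), mul_comm 2 c]
  linarith

/-- Conjugating the bound on `t ∂_t T_t` by the weight `e^{|x|²/p}` makes it symmetric in `x` and
`y`: it is controlled by a Gaussian in `s|x+y|² + |x-y|²/s`. -/
theorem exp_mul_mul_abs_deriv_heatKerA_le {n : ℕ} (hn : 1 ≤ n) {p ε κ : ℝ} (hp : 0 < p)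
    (hε0 : 0 < ε) (hε : 2 * ε ≤ 1 - p⁻¹) (hκε : 8 * κ ≤ ε) (hκp : 8 * κ ≤ p⁻¹) (hκ : 0 < κ)
    {t s G : ℝ} (ht : 0 < t)
    (x y : EuclideanSpace ℝ (Fin n)) (hs : s = 1 - Real.exp (-t) ^ 2)
    (hG : G = s * ‖x + y‖ ^ 2 + ‖x - y‖ ^ 2 / s) :
    Real.exp ((‖x‖ ^ 2 - ‖y‖ ^ 2) / p) * (t * |deriv (fun u => heatKerA n u x y) t|) ≤
      (n + 2) / ε * ((√s)⁻¹ ^ n * ((1 + ‖x‖ * √s) * Real.exp (-(κ * G)))) := by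
  obtain ⟨r, hr⟩ : ∃ r, r = Real.exp (-t) := ⟨_, rfl⟩
  rw [← hr] at hs
  have hr0 : 0 < r := hr ▸ Real.exp_pos _
  have hr1 : r < 1 := by rw [hr, Real.exp_lt_one_iff]; linarith
  have hs0 : 0 < s := by rw [hs]; nlinarith
  obtain ⟨D, hD⟩ : ∃ D, D = ‖x - r • y‖ ^ 2 / s := ⟨_, rfl⟩
  obtain ⟨D', hD'⟩ : ∃ D', D' = ‖y - r • x‖ ^ 2 / s := ⟨_, rfl⟩
  have hD0 : 0 ≤ D := by rw [hD]; positivity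
  have hD0' : 0 ≤ D' := by rw [hD']; positivity
  have hx : ‖x - r • y‖ ^ 2 = ‖x‖ ^ 2 - 2 * r * inner ℝ x y + r ^ 2 * ‖y‖ ^ 2 := by
    rw [norm_sub_sq_real, inner_smul_right, norm_smul, mul_pow, Real.norm_eq_abs, sq_abs]; ring
  have hy : ‖y - r • x‖ ^ 2 = ‖y‖ ^ 2 - 2 * r * inner ℝ x y + r ^ 2 * ‖x‖ ^ 2 := by
    rw [norm_sub_sq_real, inner_smul_right, norm_smul, mul_pow, Real.norm_eq_abs, sq_abs,
      real_inner_comm]; ring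
  have hdiff : ‖x‖ ^ 2 - ‖y‖ ^ 2 = D - D' := by
    rw [hD, hD', ← sub_div, eq_div_iff hs0.ne', hx, hy, hs]; ring
  have hsum : G ≤ 8 * (D + D') := by
    have h1 : s ≤ 2 * (1 - r) := by rw [hs]; nlinarith
    have h2 : s * s ≤ (2 * (1 - r)) * (2 * (1 - r)) := by gcongr
    rw [hD, hD', hG, ← add_div, ← mul_div_assoc, le_div_iff₀ hs0, add_mul,
      div_mul_cancel₀ _ hs0.ne', hx, hy]
    have h3 := norm_add_sq_real x y
    have h4 := norm_sub_sq_real x y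
    have h5 : 8 * (‖x‖ ^ 2 - 2 * r * inner ℝ x y + r ^ 2 * ‖y‖ ^ 2 +
        (‖y‖ ^ 2 - 2 * r * inner ℝ x y + r ^ 2 * ‖x‖ ^ 2)) =
        4 * (1 - r) ^ 2 * ‖x + y‖ ^ 2 + 4 * (1 + r) ^ 2 * ‖x - y‖ ^ 2 := by
      rw [h3, h4]; ring
    rw [h5]
    have h6 : s * s * ‖x + y‖ ^ 2 ≤ (2 * (1 - r)) * (2 * (1 - r)) * ‖x + y‖ ^ 2 := by gcongr
    have h7 : 1 * ‖x - y‖ ^ 2 ≤ 4 * (1 + r) ^ 2 * ‖x - y‖ ^ 2 := by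
      gcongr; nlinarith
    nlinarith
  have hker := mul_abs_deriv_heatKerA_le hn ht x y hr hs hD
  have hexp : Real.exp ((‖x‖ ^ 2 - ‖y‖ ^ 2) / p) * ((1 + D) * Real.exp (-D)) ≤
      ε⁻¹ * Real.exp (-(κ * G)) := by
    have h1 : 1 + D ≤ ε⁻¹ * Real.exp (ε * D) := by
      have h2 := Real.add_one_le_exp (ε * D)
      have h3 : ε ≤ 1 := by have := inv_pos.2 hp; linarith
      rw [inv_mul_eq_div, le_div_iff₀ hε0]
      linarith
    calc _ ≤ Real.exp ((‖x‖ ^ 2 - ‖y‖ ^ 2) / p) * (ε⁻¹ * Real.exp (ε * D) * Real.exp (-D)) := by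
          gcongr
      _ = ε⁻¹ * Real.exp ((D - D') / p + ε * D + -D) := by
          rw [hdiff, Real.exp_add, Real.exp_add]; ring
      _ ≤ _ := by
          gcongr
          rw [div_eq_mul_inv]
          have h2 : κ * G ≤ κ * (8 * (D + D')) := by gcongr
          have h3 : 8 * κ * D ≤ ε * D := by gcongr
          have h4 : 8 * κ * D' ≤ p⁻¹ * D' := by gcongr
          have h5 : 2 * ε * D ≤ (1 - p⁻¹) * D := by gcongr
          linarith
  calc _ ≤ Real.exp ((‖x‖ ^ 2 - ‖y‖ ^ 2) / p) *
        ((n + 2) * ((√s)⁻¹ ^ n * ((1 + D) * (1 + ‖x‖ * √s) * Real.exp (-D)))) := by gcongr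
    _ = (n + 2) * (√s)⁻¹ ^ n * (1 + ‖x‖ * √s) *
        (Real.exp ((‖x‖ ^ 2 - ‖y‖ ^ 2) / p) * ((1 + D) * Real.exp (-D))) := by ring
    _ ≤ (n + 2) * (√s)⁻¹ ^ n * (1 + ‖x‖ * √s) * (ε⁻¹ * Real.exp (-(κ * G))) := by gcongr
    _ = _ := by ring

/-- In the global region the conjugated kernel is dominated, uniformly in `t`, by `L¹`-normalized
exponentials at scale `1/(1+|x|)` and at scale `1/(1+|y|)`. -/
theorem exists_exp_mul_mul_abs_deriv_heatKerA_le {n : ℕ} (hn : 1 ≤ n) {p : ℝ} (hp : 1 < p) :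
    ∃ c : ℝ, 0 < c ∧ ∃ C : ℝ, 0 < C ∧ ∀ t : ℝ, 0 < t → ∀ x y : EuclideanSpace ℝ (Fin n),
      1 ≤ ‖x - y‖ * (1 + ‖x‖) → ∀ z, z = ‖x‖ ∨ z = ‖y‖ →
      Real.exp ((‖x‖ ^ 2 - ‖y‖ ^ 2) / p) * (t * |deriv (fun u => heatKerA n u x y) t|) ≤
        C * ((1 + z) ^ n * Real.exp (-(c * ((1 + z) * ‖x - y‖)))) := by
  have hp0 : 0 < p := by linarith
  obtain ⟨ε, hε⟩ : ∃ ε, ε = (1 - p⁻¹) / 2 := ⟨_, rfl⟩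
  have hε0 : 0 < ε := by
    have := inv_lt_one_of_one_lt₀ hp
    rw [hε]; linarith
  obtain ⟨κ, hκ⟩ : ∃ κ, κ = min ε p⁻¹ / 8 := ⟨_, rfl⟩
  have hκ0 : 0 < κ := by rw [hκ]; have := lt_min hε0 (inv_pos.2 hp0); positivity
  obtain ⟨C, hC, hCb⟩ := exists_two_add_pow_le_exp (2 * n + 1) (half_pos hκ0)
  refine ⟨κ / 4, by positivity, (n + 2) / ε * (C * Real.exp (κ / 4)), by positivity, ?_⟩
  intro t ht x y hxy z hz
  obtain ⟨s, hs⟩ : ∃ s, s = 1 - Real.exp (-t) ^ 2 := ⟨_, rfl⟩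
  obtain ⟨G, hG⟩ : ∃ G, G = s * ‖x + y‖ ^ 2 + ‖x - y‖ ^ 2 / s := ⟨_, rfl⟩
  have hb := exp_mul_mul_abs_deriv_heatKerA_le hn hp0 hε0 (by linarith)
    (by rw [hκ]; linarith [min_le_left ε p⁻¹]) (by rw [hκ]; linarith [min_le_right ε p⁻¹])
    hκ0 ht x y hs hG
  refine hb.trans ?_
  have hs0 : 0 < s := by
    have h1 : Real.exp (-t) < 1 := by rw [Real.exp_lt_one_iff]; linarith
    rw [hs]; nlinarith [Real.exp_pos (-t)]
  have hs1 : s ≤ 1 := by rw [hs]; nlinarith [Real.exp_pos (-t)]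
  obtain ⟨σ, hσ⟩ : ∃ σ, σ = √s := ⟨_, rfl⟩
  have hσ0 : 0 < σ := by rw [hσ]; positivity
  have hσ1 : σ ≤ 1 := by rw [hσ]; exact Real.sqrt_le_one.2 hs1
  have hσs : s = σ ^ 2 := by rw [hσ, Real.sq_sqrt hs0.le]
  rw [← hσ]
  obtain ⟨a, ha⟩ : ∃ a, a = σ * ‖x + y‖ := ⟨_, rfl⟩
  obtain ⟨b, hbdef⟩ : ∃ b, b = ‖x - y‖ / σ := ⟨_, rfl⟩
  have ha0 : 0 ≤ a := by rw [ha]; positivity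
  have hb0 : 0 ≤ b := by rw [hbdef]; positivity
  have hGab : G = a ^ 2 + b ^ 2 := by rw [hG, ha, hbdef, hσs]; ring
  have hG0 : 0 ≤ G := by rw [hGab]; positivity
  have hBb : ‖x - y‖ ≤ b := by
    rw [hbdef, le_div_iff₀ hσ0]; exact mul_le_of_le_one_right (norm_nonneg _) hσ1
  have haG : a ≤ 1 + G := by nlinarith [sq_nonneg (a - 1)]
  have hbG : b ≤ 1 + G := by nlinarith [sq_nonneg (b - 1)]
  have hx2 : 2 * ‖x‖ ≤ ‖x + y‖ + ‖x - y‖ := by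
    have := norm_add_le (x + y) (x - y)
    rwa [add_add_sub_cancel, ← two_smul ℝ x, norm_smul, Real.norm_two] at this
  have hy2 : 2 * ‖y‖ ≤ ‖x + y‖ + ‖x - y‖ := by
    have := norm_sub_le (x + y) (x - y)
    rwa [add_sub_sub_cancel, ← two_smul ℝ y, norm_smul, Real.norm_two] at this
  have hz2 : 2 * z ≤ ‖x + y‖ + ‖x - y‖ := by rcases hz with rfl | rfl <;> assumption
  have hz0 : 0 ≤ z := by rcases hz with rfl | rfl <;> positivity
  have hxσ : 1 + ‖x‖ * σ ≤ 2 + G := by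
    have h1 : σ * ‖x - y‖ ≤ 1 * b := by gcongr
    have h2 := mul_le_mul_of_nonneg_right hx2 hσ0.le
    linarith
  have hxz : 1 + ‖x‖ ≤ (2 + G) * (1 + z) := by
    have h1 : 0 ≤ G * (1 + z) := by positivity
    rcases hz with rfl | rfl
    · linarith
    · have h2 : ‖x‖ ≤ ‖x - y‖ + ‖y‖ := by simpa using norm_add_le (x - y) y
      have h3 : 0 ≤ G * ‖y‖ := by positivity
      linarith
  have hσinv : σ⁻¹ ≤ (2 + G) ^ 2 * (1 + z) := by
    calc σ⁻¹ ≤ σ⁻¹ * (‖x - y‖ * (1 + ‖x‖)) := le_mul_of_one_le_right (by positivity) hxy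
      _ = b * (1 + ‖x‖) := by rw [hbdef]; ring
      _ ≤ (2 + G) * ((2 + G) * (1 + z)) := by gcongr; linarith
      _ = _ := by ring
  have hzB : (1 + z) * ‖x - y‖ ≤ 1 + 2 * G := by
    have h1 : ‖x + y‖ * ‖x - y‖ = a * b := by rw [ha, hbdef]; field_simp
    have h2 : ‖x - y‖ ^ 2 ≤ b ^ 2 := by gcongr
    have h3 := mul_le_mul_of_nonneg_right hz2 (norm_nonneg (x - y))
    linarith [sq_nonneg (a - b), sq_nonneg (‖x - y‖ - 1), sq_nonneg a]
  have hexp : Real.exp (-(κ * G)) ≤ Real.exp (-(κ / 2 * G)) *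
      (Real.exp (κ / 4) * Real.exp (-(κ / 4 * ((1 + z) * ‖x - y‖)))) := by
    rw [← Real.exp_add, ← Real.exp_add]
    gcongr
    have := mul_le_mul_of_nonneg_left hzB (by positivity : 0 ≤ κ / 4)
    linarith
  calc _ ≤ (n + 2) / ε * (((2 + G) ^ 2 * (1 + z)) ^ n * ((2 + G) *
        (Real.exp (-(κ / 2 * G)) *
          (Real.exp (κ / 4) * Real.exp (-(κ / 4 * ((1 + z) * ‖x - y‖))))))) := by gcongr
    _ = (n + 2) / ε * ((2 + G) ^ (2 * n + 1) * Real.exp (-(κ / 2 * G)) * Real.exp (κ / 4) *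
        ((1 + z) ^ n * Real.exp (-(κ / 4 * ((1 + z) * ‖x - y‖))))) := by
        rw [mul_pow, ← pow_mul, pow_succ]; ring
    _ ≤ (n + 2) / ε * (C * Real.exp (κ / 2 * G) * Real.exp (-(κ / 2 * G)) * Real.exp (κ / 4) *
        ((1 + z) ^ n * Real.exp (-(κ / 4 * ((1 + z) * ‖x - y‖))))) := by
        gcongr; exact hCb G hG0
    _ = _ := by
        rw [mul_assoc C, ← Real.exp_add, add_neg_cancel, Real.exp_zero]; ring

/-- **Schur's test** for nonnegative kernels. -/
theorem lintegral_lintegral_mul_rpow_le {α : Type*} [MeasurableSpace α] {μ : Measure α} [SFinite μ]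
    {p : ℝ} (hp : 1 < p) {H : α → α → ℝ≥0∞} (hH : Measurable (Function.uncurry H)) {M : ℝ≥0∞}
    (hrow : ∀ x, ∫⁻ y, H x y ∂μ ≤ M) (hcol : ∀ y, ∫⁻ x, H x y ∂μ ≤ M)
    {f : α → ℝ≥0∞} (hf : Measurable f) :
    ∫⁻ x, (∫⁻ y, H x y * f y ∂μ) ^ p ∂μ ≤ M ^ p * ∫⁻ y, f y ^ p ∂μ := by
  have hp0 : 0 < p := by linarith
  obtain ⟨q, hpq⟩ : ∃ q, p.HolderConjugate q := ⟨_, Real.HolderConjugate.conjExponent hp⟩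
  have hq0 : 0 < q := hpq.symm.pos
  have hpt : ∀ x, (∫⁻ y, H x y * f y ∂μ) ^ p ≤ M ^ (p / q) * ∫⁻ y, H x y * f y ^ p ∂μ := by
    intro x
    have hHx : Measurable (H x) := hH.of_uncurry_left
    have h := ENNReal.lintegral_mul_le_Lp_mul_Lq μ hpq.symm
      (f := fun y => H x y ^ (1 / q)) (g := fun y => H x y ^ (1 / p) * f y)
      (by fun_prop) (by fun_prop)
    have h1 : ∀ y, ((fun y => H x y ^ (1 / q)) * fun y => H x y ^ (1 / p) * f y) y
        = H x y * f y := by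
      intro y
      rw [Pi.mul_apply, ← mul_assoc, ← ENNReal.rpow_add_of_nonneg _ _ (by positivity)
        (by positivity), one_div, one_div, hpq.symm.inv_add_inv_eq_one, ENNReal.rpow_one]
    have h2 : ∀ y, (H x y ^ (1 / p) * f y) ^ p = H x y * f y ^ p := by
      intro y
      rw [ENNReal.mul_rpow_of_nonneg _ _ hp0.le, ← ENNReal.rpow_mul, one_div_mul_cancel hp0.ne',
        ENNReal.rpow_one]
    have h3 : ∀ y, (H x y ^ (1 / q)) ^ q = H x y := by
      intro y
      rw [← ENNReal.rpow_mul, one_div_mul_cancel hq0.ne', ENNReal.rpow_one]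
    simp_rw [h1, h2, h3] at h
    calc _ ≤ ((∫⁻ y, H x y ∂μ) ^ (1 / q) * (∫⁻ y, H x y * f y ^ p ∂μ) ^ (1 / p)) ^ p := by gcongr
      _ = (∫⁻ y, H x y ∂μ) ^ (p / q) * ∫⁻ y, H x y * f y ^ p ∂μ := by
        rw [ENNReal.mul_rpow_of_nonneg _ _ hp0.le, ← ENNReal.rpow_mul, ← ENNReal.rpow_mul,
          one_div_mul_cancel hp0.ne', ENNReal.rpow_one, one_div_mul_eq_div]
      _ ≤ _ := by gcongr; exact hrow x
  calc _ ≤ ∫⁻ x, M ^ (p / q) * ∫⁻ y, H x y * f y ^ p ∂μ ∂μ := lintegral_mono hpt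
    _ = M ^ (p / q) * ∫⁻ x, ∫⁻ y, H x y * f y ^ p ∂μ ∂μ := by
      rw [lintegral_const_mul]
      exact Measurable.lintegral_prod_right (hH.mul ((hf.comp measurable_snd).pow_const p))
    _ = M ^ (p / q) * ∫⁻ y, (∫⁻ x, H x y ∂μ) * f y ^ p ∂μ := by
      rw [lintegral_lintegral_swap (hH.mul ((hf.comp measurable_snd).pow_const p)).aemeasurable]
      congr 1
      refine lintegral_congr fun y => ?_
      rw [lintegral_mul_const]
      exact hH.of_uncurry_right
    _ ≤ M ^ (p / q) * ∫⁻ y, M * f y ^ p ∂μ := by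
      gcongr with y; exact hcol y
    _ = _ := by
      rw [lintegral_const_mul _ (hf.pow_const p), ← mul_assoc]
      congr 1
      have h : p = p / q + 1 := by
        have := hpq.inv_add_inv_eq_one
        field_simp at this ⊢
        linarith
      conv_rhs => rw [h, ENNReal.rpow_add_of_nonneg _ _ (by positivity) zero_le_one,
        ENNReal.rpow_one]

/-- The `L¹` norm of `ρⁿ e^{-cρ|·|}` is finite and does not depend on the scale `ρ`. -/
theorem exists_lintegral_exp_norm_le {n : ℕ} {c : ℝ} (hc : 0 < c) {C : ℝ} (hC : 0 ≤ C) :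
    ∃ M : ℝ≥0∞, M ≠ ∞ ∧ ∀ ρ : ℝ, 0 < ρ →
      ∫⁻ z : EuclideanSpace ℝ (Fin n),
        ENNReal.ofReal (C * (ρ ^ n * Real.exp (-(c * (ρ * ‖z‖))))) ≤ M := by
  refine ⟨∫⁻ z : EuclideanSpace ℝ (Fin n), ENNReal.ofReal (C * Real.exp (-(c * ‖z‖))), ?_, ?_⟩
  · obtain ⟨K, hK, hKb⟩ := exists_two_add_pow_le_exp (n + 1) hc
    have hfin := finite_integral_one_add_norm (E := EuclideanSpace ℝ (Fin n)) (μ := volume)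
      (r := (n + 1 : ℕ)) (by simp)
    refine ((lintegral_mono (g := fun z : EuclideanSpace ℝ (Fin n) =>
      ENNReal.ofReal (C * K) * ENNReal.ofReal ((1 + ‖z‖) ^ (-((n + 1 : ℕ) : ℝ)))) fun z => ?_).trans_lt
      ?_).ne
    · beta_reduce
      rw [← ENNReal.ofReal_mul (by positivity)]
      refine ENNReal.ofReal_le_ofReal ?_
      rw [mul_assoc]
      refine mul_le_mul_of_nonneg_left ?_ hC
      rw [Real.rpow_neg (by positivity), Real.rpow_natCast, ← div_eq_mul_inv,
        le_div_iff₀ (by positivity), Real.exp_neg, inv_mul_le_iff₀ (by positivity), mul_comm _ K]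
      refine le_trans ?_ (hKb ‖z‖ (norm_nonneg z))
      gcongr; norm_num
    · rw [lintegral_const_mul' _ _ ENNReal.ofReal_ne_top]
      exact ENNReal.mul_lt_top ENNReal.ofReal_lt_top hfin
  · intro ρ hρ
    have h1 : ∀ z : EuclideanSpace ℝ (Fin n),
        ENNReal.ofReal (C * (ρ ^ n * Real.exp (-(c * (ρ * ‖z‖))))) =
        ENNReal.ofReal (ρ ^ n) * ENNReal.ofReal (C * Real.exp (-(c * ‖ρ • z‖))) := by
      intro z
      rw [← ENNReal.ofReal_mul (by positivity), norm_smul, Real.norm_of_nonneg hρ.le]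
      ring_nf
    simp_rw [h1]
    rw [lintegral_const_mul _ (by fun_prop),
      ← lintegral_map (f := fun z : EuclideanSpace ℝ (Fin n) =>
        ENNReal.ofReal (C * Real.exp (-(c * ‖z‖)))) (g := fun z => ρ • z) (by fun_prop)
        (by fun_prop), Measure.map_addHaar_smul _ hρ.ne', lintegral_smul_measure, smul_eq_mul,
      ← mul_assoc, ← ENNReal.ofReal_mul (by positivity), finrank_euclideanSpace_fin,
      abs_of_pos (by positivity), mul_inv_cancel₀ (by positivity), ENNReal.ofReal_one, one_mul]

/-- For `1 < p < ∞` there exists `β > 0` such that the operator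
`g ↦ ∫ sup_{t>0} |t ∂_t T_t^𝒜(x,y)| χ_{N_βᶜ}(x,y) g(y) dy` is bounded on `L^p(ℝⁿ, γ₋₁)`. -/
theorem stmt16 (n : ℕ) (hn : 1 ≤ n) (p : ℝ) (hp : 1 < p) :
    ∃ β : ℝ, 0 < β ∧ ∃ C : ℝ, 0 < C ∧
      ∀ g : EuclideanSpace ℝ (Fin n) → ℝ≥0∞, Measurable g →
      (∫⁻ x, (∫⁻ y, (⨆ (t : ℝ) (_ : 0 < t),
              ENNReal.ofReal (t * |deriv (fun s => heatKerA n s x y) t|)) *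
            Set.indicator ((localNb n β)ᶜ) (fun _ => (1 : ℝ≥0∞)) (x, y) * g y ∂volume) ^ p
          ∂gammaM1 n)
        ≤ ENNReal.ofReal C * ∫⁻ y, g y ^ p ∂gammaM1 n := by
  have hp0 : 0 < p := by linarith
  obtain ⟨c, hc, C, hC, hbound⟩ := exists_exp_mul_mul_abs_deriv_heatKerA_le hn hp
  obtain ⟨M, hM, hMb⟩ := exists_lintegral_exp_norm_le (n := n) hc hC.le
  let Φ : ℝ → ℝ → ℝ≥0∞ := fun ρ b => ENNReal.ofReal (C * (ρ ^ n * Real.exp (-(c * (ρ * b)))))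
  let H : EuclideanSpace ℝ (Fin n) → EuclideanSpace ℝ (Fin n) → ℝ≥0∞ := fun x y =>
    min (Φ (1 + ‖x‖) ‖x - y‖) (Φ (1 + ‖y‖) ‖x - y‖)
  have hH : Measurable (Function.uncurry H) := by
    simp only [H, Φ, Function.uncurry_def]
    fun_prop
  have hrow : ∀ x, ∫⁻ y, H x y ≤ M := fun x =>
    calc ∫⁻ y, H x y ≤ ∫⁻ y, Φ (1 + ‖x‖) ‖x - y‖ := lintegral_mono fun y => min_le_left _ _
      _ = ∫⁻ z : EuclideanSpace ℝ (Fin n), Φ (1 + ‖x‖) ‖z‖ :=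
        lintegral_sub_left_eq_self (fun z => Φ (1 + ‖x‖) ‖z‖) x
      _ ≤ M := hMb _ (by positivity)
  have hcol : ∀ y, ∫⁻ x, H x y ≤ M := fun y =>
    calc ∫⁻ x, H x y ≤ ∫⁻ x, Φ (1 + ‖y‖) ‖x - y‖ := lintegral_mono fun x => min_le_right _ _
      _ = ∫⁻ z : EuclideanSpace ℝ (Fin n), Φ (1 + ‖y‖) ‖z‖ :=
        lintegral_sub_right_eq_self (fun z => Φ (1 + ‖y‖) ‖z‖) y
      _ ≤ M := hMb _ (by positivity)
  let w : EuclideanSpace ℝ (Fin n) → ℝ≥0∞ := fun x => ENNReal.ofReal (Real.exp (‖x‖ ^ 2 / p))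
  have hw : Measurable w := by fun_prop
  have hw0 : ∀ x, w x ≠ 0 := fun x => (ENNReal.ofReal_pos.2 (Real.exp_pos _)).ne'
  have hwtop : ∀ x, w x ≠ ∞ := fun x => ENNReal.ofReal_ne_top
  let P : ℝ≥0∞ := ENNReal.ofReal (Real.pi ^ ((n : ℝ) / 2))
  have hdens : (fun x : EuclideanSpace ℝ (Fin n) =>
      ENNReal.ofReal (Real.pi ^ ((n : ℝ) / 2) * Real.exp (‖x‖ ^ 2))) = fun x => P * w x ^ p := by
    funext x
    rw [ENNReal.ofReal_mul (by positivity), ENNReal.ofReal_rpow_of_pos (Real.exp_pos _),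
      ← Real.exp_mul, div_mul_cancel₀ _ hp0.ne']
  have hγ : gammaM1 n = volume.withDensity fun x => P * w x ^ p := by rw [gammaM1, hdens]
  have hdm : Measurable fun x => P * w x ^ p := by fun_prop
  have hK : ∀ x y, w x * ((⨆ (t : ℝ) (_ : 0 < t),
      ENNReal.ofReal (t * |deriv (fun s => heatKerA n s x y) t|)) *
        Set.indicator ((localNb n 1)ᶜ) (fun _ => (1 : ℝ≥0∞)) (x, y)) ≤ H x y * w y := by
    intro x y
    by_cases hxy : (x, y) ∈ localNb n 1
    · simp [hxy]
    have hglob : 1 ≤ ‖x - y‖ * (1 + ‖x‖) := by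
      by_contra! hlt
      refine hxy ⟨?_, ?_⟩ <;> nlinarith [norm_nonneg (x - y), norm_nonneg x,
        mul_nonneg (norm_nonneg (x - y)) (norm_nonneg x)]
    rw [Set.indicator_of_mem (Set.mem_compl hxy), mul_one, mul_comm]
    rw [← ENNReal.le_div_iff_mul_le (Or.inl (hw0 x)) (Or.inl (hwtop x))]
    refine iSup₂_le fun t ht => ?_
    rw [ENNReal.le_div_iff_mul_le (Or.inl (hw0 x)) (Or.inl (hwtop x))]
    have hz : ∀ z, z = ‖x‖ ∨ z = ‖y‖ →
        ENNReal.ofReal (t * |deriv (fun s => heatKerA n s x y) t|) * w x ≤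
          Φ (1 + z) ‖x - y‖ * w y := by
      intro z hz
      have hz0 : 0 ≤ z := by rcases hz with rfl | rfl <;> positivity
      rw [← ENNReal.ofReal_mul (by positivity), ← ENNReal.ofReal_mul (by positivity)]
      refine ENNReal.ofReal_le_ofReal ?_
      have h := hbound t ht x y hglob z hz
      rw [sub_div, Real.exp_sub, div_mul_eq_mul_div, div_le_iff₀ (Real.exp_pos _)] at h
      linarith
    rcases min_choice (Φ (1 + ‖x‖) ‖x - y‖) (Φ (1 + ‖y‖) ‖x - y‖) with h | h
    · simp only [H, h]; exact hz _ (Or.inl rfl)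
    · simp only [H, h]; exact hz _ (Or.inr rfl)
  refine ⟨1, one_pos, (M ^ p).toReal + 1, by positivity, fun g hg => ?_⟩
  rw [hγ, lintegral_withDensity_eq_lintegral_mul _ hdm (hg.pow_const p)]
  refine (lintegral_withDensity_le_lintegral_mul _ hdm _).trans ?_
  have hMC : M ^ p ≤ ENNReal.ofReal ((M ^ p).toReal + 1) := by
    rw [← ENNReal.ofReal_toReal (ENNReal.rpow_ne_top_of_nonneg hp0.le hM)]
    refine ENNReal.ofReal_le_ofReal ?_
    rw [ENNReal.toReal_ofReal ENNReal.toReal_nonneg]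
    linarith
  calc _ ≤ ∫⁻ x, P * (∫⁻ y, H x y * (w y * g y)) ^ p := by
        refine lintegral_mono fun x => ?_
        simp only [Pi.mul_apply]
        rw [mul_assoc, ← ENNReal.mul_rpow_of_nonneg _ _ hp0.le,
          ← lintegral_const_mul' _ _ (hwtop x)]
        refine mul_le_mul_right (ENNReal.rpow_le_rpow (lintegral_mono fun y => ?_) hp0.le) P
        rw [← mul_assoc, ← mul_assoc (H x y)]
        exact mul_le_mul_left (hK x y) (g y)
    _ = P * ∫⁻ x, (∫⁻ y, H x y * (w y * g y)) ^ p := lintegral_const_mul' _ _ ENNReal.ofReal_ne_top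
    _ ≤ P * (M ^ p * ∫⁻ y, (w y * g y) ^ p) := by
        gcongr
        exact lintegral_lintegral_mul_rpow_le hp hH hrow hcol (hw.mul hg)
    _ = M ^ p * ∫⁻ y, P * (w y * g y) ^ p := by
        rw [lintegral_const_mul' _ _ ENNReal.ofReal_ne_top]; ring
    _ ≤ ENNReal.ofReal ((M ^ p).toReal + 1) * ∫⁻ y, P * (w y * g y) ^ p := by gcongr
    _ = _ := by
        congr 1
        refine lintegral_congr fun y => ?_
        rw [ENNReal.mul_rpow_of_nonneg _ _ hp0.le, Pi.mul_apply, mul_assoc]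
end

section
/- Let n ≥ 1. The maximal operator T^𝒜_{*,1}(f)(x) = sup_{t>0} |t ∂_t ∫_{ℝⁿ} T_t^𝒜(x,y) f(y) dy| is bounded from L¹(ℝⁿ, γ₋₁) into L^{1,∞}(ℝⁿ, γ₋₁): there exists C > 0 such that for every f ∈ L¹(ℝⁿ, γ₋₁) and every λ > 0, γ₋₁({x ∈ ℝⁿ : T^𝒜_{*,1}(f)(x) > λ}) ≤ C λ^{−1} ∫_{ℝⁿ} |f(y)| γ₋₁(y) dy. -/
open MeasureTheory Real
open scoped ENNReal

namespace InverseGaussian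

/-- Euclidean space of dimension `m + 1`. -/
abbrev Euc (m : ℕ) := EuclideanSpace ℝ (Fin (m + 1))

/-- A polynomially decaying profile, integrable on `Euc m`. -/
noncomputable def decay (m : ℕ) (u : ℝ) : ℝ := ((1 + u) ^ (m + 2))⁻¹

lemma decay_pos (m : ℕ) {u : ℝ} (hu : 0 ≤ u) : 0 < decay m u := by
  unfold decay; positivity

lemma decay_le_one (m : ℕ) {u : ℝ} (hu : 0 ≤ u) : decay m u ≤ 1 :=
  inv_le_one_of_one_le₀ (one_le_pow₀ (by linarith))

lemma measurable_decay (m : ℕ) : Measurable (decay m) := by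
  unfold decay; fun_prop

lemma decay_le_mul_decay (m : ℕ) {u v c : ℝ} (hu : 0 ≤ u) (hv : 0 ≤ v) (_hc : 0 < c)
    (h : 1 + v ≤ c * (1 + u)) : decay m u ≤ c ^ (m + 2) * decay m v := by
  unfold decay
  rw [← div_eq_mul_inv, inv_eq_one_div, div_le_div_iff₀ (by positivity) (by positivity), one_mul,
    ← mul_pow]
  exact pow_le_pow_left₀ (by linarith) h _

lemma exists_exp_neg_le_decay (m : ℕ) :
    ∃ C : ℝ, 1 ≤ C ∧ ∀ u : ℝ, 0 ≤ u → exp (-u) ≤ C * decay m u := by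
  have hf : (1 : ℝ) ≤ (m + 2).factorial := by exact_mod_cast Nat.factorial_pos _
  refine ⟨(m + 2).factorial * exp 1, ?_, fun u hu => ?_⟩
  · nlinarith [Real.add_one_le_exp 1]
  · have h := Real.pow_div_factorial_le_exp (x := 1 + u) (by linarith) (m + 2)
    rw [div_le_iff₀ (by positivity), Real.exp_add] at h
    unfold decay
    rw [Real.exp_neg, ← div_eq_mul_inv, inv_eq_one_div,
      div_le_div_iff₀ (by positivity) (by positivity)]
    linarith

lemma exists_lintegral_decay_le (m : ℕ) :
    ∃ I : ℝ, 0 < I ∧ ∀ (a : ℝ) (c : Euc m), 0 < a →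
      ∫⁻ x : Euc m, ENNReal.ofReal (decay m (a * ‖x - c‖)) ≤ ENNReal.ofReal (I / a ^ (m + 1)) := by
  have hint : Integrable (fun x : Euc m => decay m ‖x‖) := by
    have := integrable_one_add_norm (E := Euc m) (μ := volume) (r := ((m + 2 : ℕ) : ℝ))
      (by simp)
    refine this.congr (Filter.Eventually.of_forall fun x => ?_)
    simp only [decay]
    rw [Real.rpow_neg (by positivity), Real.rpow_natCast]
  refine ⟨(∫ x : Euc m, decay m ‖x‖) + 1, ?_, fun a c ha => ?_⟩
  · have : 0 ≤ ∫ x : Euc m, decay m ‖x‖ := integral_nonneg fun x => (decay_pos m (norm_nonneg x)).le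
    linarith
  · have h1 : ∫⁻ x : Euc m, ENNReal.ofReal (decay m (a * ‖x - c‖))
        = ∫⁻ x : Euc m, ENNReal.ofReal (decay m (‖a • x‖)) := by
      rw [← lintegral_sub_right_eq_self (μ := (volume : Measure (Euc m)))
        (fun x : Euc m => ENNReal.ofReal (decay m (‖a • x‖))) c]
      simp [norm_smul, abs_of_pos ha]
    have hint2 : Integrable (fun x : Euc m => decay m ‖a • x‖) :=
      hint.comp_smul ha.ne'
    rw [h1, ← ofReal_integral_eq_lintegral_ofReal hint2
      (Filter.Eventually.of_forall fun x => (decay_pos m (norm_nonneg _)).le)]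
    refine ENNReal.ofReal_le_ofReal ?_
    rw [Measure.integral_comp_smul_of_nonneg volume (fun x : Euc m => decay m ‖x‖) a (hR := ha.le)]
    simp only [finrank_euclideanSpace, Fintype.card_fin, smul_eq_mul]
    rw [div_eq_inv_mul]
    gcongr
    linarith

lemma exists_volume_ball_eq (m : ℕ) :
    ∃ v : ℝ, 0 < v ∧ ∀ (x : Euc m) (r : ℝ), 0 ≤ r →
      volume (Metric.ball x r) = ENNReal.ofReal (v * r ^ (m + 1)) := by
  refine ⟨(volume (Metric.ball (0 : Euc m) 1)).toReal, ?_, fun x r hr => ?_⟩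
  · exact ENNReal.toReal_pos (Metric.measure_ball_pos _ _ one_pos).ne' measure_ball_lt_top.ne
  · rw [Measure.addHaar_ball volume x hr, finrank_euclideanSpace, Fintype.card_fin, mul_comm,
      ENNReal.ofReal_mul (by positivity), ENNReal.ofReal_toReal measure_ball_lt_top.ne]

/-- Two points are separated when neither lies in the cone below the other. -/
def Sep {m : ℕ} (a b : Euc m) : Prop :=
  1 + 4 * |‖a‖ ^ 2 - ‖b‖ ^ 2| < max ‖a‖ ‖b‖ * ‖a - b‖

lemma Sep.symm {m : ℕ} {a b : Euc m} (h : Sep a b) : Sep b a := by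
  unfold Sep at *
  rwa [abs_sub_comm, max_comm, norm_sub_rev]

lemma max_norm_mul_abs_le {m : ℕ} (a b : Euc m) :
    max ‖a‖ ‖b‖ * |‖a‖ - ‖b‖| ≤ |‖a‖ ^ 2 - ‖b‖ ^ 2| := by
  have h : |‖a‖ ^ 2 - ‖b‖ ^ 2| = (‖a‖ + ‖b‖) * |‖a‖ - ‖b‖| := by
    rw [sq_sub_sq, abs_mul, abs_of_nonneg (by positivity : 0 ≤ ‖a‖ + ‖b‖)]
  rw [h]
  gcongr
  exact max_le (by linarith [norm_nonneg b]) (by linarith [norm_nonneg a])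

lemma Sep.le_norm_smul_sub_smul {m : ℕ} {x x' : Euc m} (h : Sep x x') {P a a' : ℝ} (hP : 0 < P)
    (hx : ‖x‖ ≤ P) (hx' : ‖x'‖ ≤ P) (ha : 1 ≤ a) (ha' : 0 < a') :
    1 / (2 * P) ≤ ‖a • x - a' • x'‖ := by
  by_contra! hlt
  have ha0 : 0 < a := by linarith
  set κ := a' / a with hκ
  have hκ0 : 0 < κ := by positivity
  have h1 : ‖x - κ • x'‖ < 1 / (2 * P) := by
    have : a • x - a' • x' = a • (x - κ • x') := by
      rw [smul_sub, smul_smul, hκ, mul_div_cancel₀ _ ha0.ne']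
    rw [this, norm_smul, Real.norm_of_nonneg ha0.le] at hlt
    nlinarith [norm_nonneg (x - κ • x')]
  have h2 : |‖x‖ - κ * ‖x'‖| < 1 / (2 * P) := by
    have := abs_norm_sub_norm_le x (κ • x')
    rw [norm_smul, Real.norm_of_nonneg hκ0.le] at this
    linarith
  have h3 : ‖x - x'‖ ≤ ‖x - κ • x'‖ + |κ * ‖x'‖ - ‖x'‖| := by
    have h4 : ‖κ • x' - x'‖ = |κ * ‖x'‖ - ‖x'‖| := by
      have : κ • x' - x' = (κ - 1) • x' := by rw [sub_smul, one_smul]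
      rw [this, norm_smul, Real.norm_eq_abs, ← abs_of_nonneg (norm_nonneg x'), ← abs_mul,
        abs_of_nonneg (norm_nonneg x')]
      ring_nf
    rw [← h4]
    calc ‖x - x'‖ = ‖(x - κ • x') + (κ • x' - x')‖ := by congr 1; abel
      _ ≤ _ := norm_add_le _ _
  have h5 : |κ * ‖x'‖ - ‖x'‖| ≤ |‖x‖ - κ * ‖x'‖| + |‖x‖ - ‖x'‖| := by
    have := abs_sub_le (κ * ‖x'‖) ‖x‖ ‖x'‖
    rwa [abs_sub_comm (κ * ‖x'‖) ‖x‖] at this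
  have h6 : ‖x - x'‖ ≤ 1 / P + |‖x‖ - ‖x'‖| := by
    have : 1 / P = 1 / (2 * P) + 1 / (2 * P) := by field_simp; norm_num
    linarith
  have h7 : max ‖x‖ ‖x'‖ * ‖x - x'‖ ≤ 1 + |‖x‖ ^ 2 - ‖x'‖ ^ 2| := by
    have hM : max ‖x‖ ‖x'‖ ≤ P := max_le hx hx'
    have hM0 : 0 ≤ max ‖x‖ ‖x'‖ := le_max_of_le_left (norm_nonneg x)
    calc max ‖x‖ ‖x'‖ * ‖x - x'‖ ≤ max ‖x‖ ‖x'‖ * (1 / P + |‖x‖ - ‖x'‖|) := by gcongr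
      _ = max ‖x‖ ‖x'‖ / P + max ‖x‖ ‖x'‖ * |‖x‖ - ‖x'‖| := by ring
      _ ≤ 1 + _ := add_le_add ((div_le_one hP).2 hM) (max_norm_mul_abs_le x x')
  unfold Sep at h
  linarith [abs_nonneg (‖x‖ ^ 2 - ‖x'‖ ^ 2)]

lemma pairwiseDisjoint_tube_balls {m : ℕ} {S : Finset (Euc m)} {P : ℝ} (hP : 1 ≤ P)
    (hS : ∀ x ∈ S, P / 2 ≤ ‖x‖ ∧ ‖x‖ ≤ P) (hsep : (S : Set (Euc m)).Pairwise Sep) (K : ℕ) :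
    ((S ×ˢ Finset.range K : Finset (Euc m × ℕ)) : Set (Euc m × ℕ)).PairwiseDisjoint
      fun p => Metric.ball ((1 + p.2 / P ^ 2) • p.1) (1 / (4 * P)) := by
  have hP0 : 0 < P := by linarith
  rintro ⟨x, k⟩ hx ⟨x', k'⟩ hx' hne
  simp only [Finset.coe_product, Set.mem_prod, Finset.mem_coe] at hx hx'
  refine Metric.ball_disjoint_ball ?_
  have e : 1 / (4 * P) + 1 / (4 * P) = 1 / (2 * P) := by field_simp; norm_num
  rw [e, dist_eq_norm]
  by_cases hxx : x = x'
  · subst hxx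
    have hk : k ≠ k' := by rintro rfl; exact hne rfl
    simp only
    rw [← sub_smul, norm_smul, Real.norm_eq_abs]
    have h1 : (1 : ℝ) ≤ |(k : ℝ) - k'| := by
      have : (1 : ℤ) ≤ |(k : ℤ) - k'| := Int.one_le_abs (by omega)
      exact_mod_cast this
    have h2 : |1 + (k : ℝ) / P ^ 2 - (1 + k' / P ^ 2)| = |(k : ℝ) - k'| / P ^ 2 := by
      rw [← abs_of_pos (by positivity : 0 < P ^ 2), ← abs_div, abs_of_pos (by positivity : 0 < P ^ 2)]
      ring_nf
    rw [h2]
    calc 1 / (2 * P) = 1 / P ^ 2 * (P / 2) := by field_simp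
      _ ≤ _ := by
        gcongr
        exact (hS x hx.1).1
  · refine (hsep hx.1 hx'.1 hxx).le_norm_smul_sub_smul hP0 (hS x hx.1).2 (hS x' hx'.1).2 ?_ ?_
    · have : (0 : ℝ) ≤ k / P ^ 2 := by positivity
      simpa using this
    · positivity

/-- A sum of bumps of width `b` strung along the segment of direction `e`. -/
noncomputable def tubeProfile (m N : ℕ) (b : ℝ) (e x : Euc m) : ℝ :=
  ∑ i ∈ Finset.Icc (-(N : ℤ)) N, decay m (b⁻¹ * ‖x - (i * b) • e‖)

lemma decay_le_tubeProfile {m N : ℕ} {b d P α θ : ℝ} {e x p : Euc m} (hb : 0 < b) (hbP : b ≤ P)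
    (hPb : 1 ≤ P * b) (he : ‖e‖ = 1) (hx : ‖x‖ ≤ P) (hα : ‖x - α • e‖ ≤ d)
    (hθ : 1 ≤ θ) (hθ' : θ ≤ 2) (hp : p ∈ Metric.ball (θ • x) (1 / (4 * P)))
    (hN : 4 * P / b + 1 ≤ N) :
    decay m (d / b) ≤ 3 ^ (m + 2) * tubeProfile m N b e p := by
  have hP : 0 < P := by linarith
  have hd : 0 ≤ d := (norm_nonneg _).trans hα
  obtain ⟨β, hβ, hβP⟩ : ∃ β : ℝ, ‖x - β • e‖ ≤ d ∧ |β| ≤ 2 * P := by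
    by_cases h : |α| ≤ 2 * P
    · exact ⟨α, hα, h⟩
    · refine ⟨0, ?_, by simpa using hP.le⟩
      push Not at h
      have h1 : |α| ≤ ‖x‖ + d := by
        have : ‖α • e‖ ≤ ‖x‖ + ‖x - α • e‖ := by
          calc ‖α • e‖ = ‖x - (x - α • e)‖ := by congr 1; abel
            _ ≤ _ := norm_sub_le _ _
        rw [norm_smul, he, mul_one, Real.norm_eq_abs] at this
        linarith
      simp only [zero_smul, sub_zero]
      linarith
  set i : ℤ := ⌊θ * β / b⌋ with hi
  have hi1 : (i : ℝ) ≤ θ * β / b := Int.floor_le _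
  have hi2 : θ * β / b < i + 1 := Int.lt_floor_add_one _
  have habs : |θ * β / b| ≤ 4 * P / b := by
    rw [abs_div, abs_mul, abs_of_pos hb, abs_of_pos (by linarith : 0 < θ)]
    exact div_le_div_of_nonneg_right (by nlinarith [abs_nonneg β]) hb.le
  have hmem : i ∈ Finset.Icc (-(N : ℤ)) N := by
    rw [abs_le] at habs
    rw [Finset.mem_Icc]
    constructor
    · have : (-(N : ℝ)) ≤ i := by linarith
      exact_mod_cast this
    · have : (i : ℝ) ≤ N := by linarith
      exact_mod_cast this
  have h1 : |θ * β - i * b| ≤ b := by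
    rw [le_div_iff₀ hb] at hi1
    rw [div_lt_iff₀ hb] at hi2
    rw [abs_le]
    constructor <;> linarith
  have h2 : ‖p - (i * b) • e‖ ≤ 2 * d + 2 * b := by
    have e1 : p - (i * b) • e = (p - θ • x) + θ • (x - β • e) + (θ * β - i * b) • e := by
      rw [smul_sub, sub_smul, smul_smul]; abel
    have hp' : ‖p - θ • x‖ < 1 / (4 * P) := by rwa [← dist_eq_norm]
    have hPb' : 1 / (4 * P) ≤ b := by
      rw [div_le_iff₀ (by positivity)]; linarith
    rw [e1]
    refine (norm_add_le _ _).trans ((add_le_add_left (norm_add_le _ _) _).trans ?_)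
    rw [norm_smul, norm_smul, he, mul_one, Real.norm_eq_abs, Real.norm_eq_abs,
      abs_of_pos (by linarith : 0 < θ)]
    nlinarith [norm_nonneg (x - β • e)]
  have h3 : decay m (d / b) ≤ 3 ^ (m + 2) * decay m (b⁻¹ * ‖p - (i * b) • e‖) := by
    refine decay_le_mul_decay m (by positivity) (by positivity) (by norm_num) ?_
    calc 1 + b⁻¹ * ‖p - (i * b) • e‖ ≤ 1 + b⁻¹ * (2 * d + 2 * b) := by gcongr
      _ = 3 + 2 * (d / b) := by field_simp; ring
      _ ≤ _ := by
        have : 0 ≤ d / b := by positivity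
        linarith
  refine h3.trans ?_
  gcongr
  exact Finset.single_le_sum (f := fun i : ℤ => decay m (b⁻¹ * ‖p - (i * b) • e‖))
    (fun i _ => (decay_pos m (by positivity)).le) hmem

lemma measurable_tubeProfile (m N : ℕ) (b : ℝ) (e : Euc m) :
    Measurable (tubeProfile m N b e) := by
  unfold tubeProfile
  refine Finset.measurable_sum _ fun i _ => (measurable_decay m).comp ?_
  fun_prop

lemma lintegral_tubeProfile_le {m N : ℕ} {b I : ℝ} {e : Euc m} (hb : 0 < b)
    (hI : ∀ (a : ℝ) (c : Euc m), 0 < a →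
      ∫⁻ x : Euc m, ENNReal.ofReal (decay m (a * ‖x - c‖)) ≤ ENNReal.ofReal (I / a ^ (m + 1))) :
    ∫⁻ x, ENNReal.ofReal (tubeProfile m N b e x)
      ≤ ENNReal.ofReal ((2 * N + 1) * (I * b ^ (m + 1))) := by
  have h : ∀ x, ENNReal.ofReal (tubeProfile m N b e x)
      = ∑ i ∈ Finset.Icc (-(N : ℤ)) N, ENNReal.ofReal (decay m (b⁻¹ * ‖x - (i * b) • e‖)) := by
    intro x
    exact ENNReal.ofReal_sum_of_nonneg fun i _ => (decay_pos m (by positivity)).le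
  simp_rw [h]
  rw [lintegral_finsetSum]
  swap
  · intro i _
    exact ((measurable_decay m).comp
      (g := decay m) (f := fun x : Euc m => b⁻¹ * ‖x - (i * b) • e‖) (by fun_prop)).ennreal_ofReal
  refine (Finset.sum_le_sum fun i _ => hI b⁻¹ _ (by positivity)).trans ?_
  rw [Finset.sum_const, nsmul_eq_mul, ENNReal.ofReal_mul (by positivity)]
  simp only [Int.card_Icc, inv_pow, div_inv_eq_mul]
  gcongr
  rw [← ENNReal.ofReal_natCast]
  refine ENNReal.ofReal_le_ofReal (le_of_eq ?_)
  have : ((N : ℤ) + 1 - -(N : ℤ)).toNat = 2 * N + 1 := by omega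
  rw [this]; push_cast; ring

lemma sum_decay_mul_sq_le {m : ℕ} {I v : ℝ} (hI0 : 0 < I)
    (hI : ∀ (a : ℝ) (c : Euc m), 0 < a →
      ∫⁻ x : Euc m, ENNReal.ofReal (decay m (a * ‖x - c‖)) ≤ ENNReal.ofReal (I / a ^ (m + 1)))
    (hv0 : 0 < v) (hv : ∀ (x : Euc m) (r : ℝ), 0 ≤ r →
      volume (Metric.ball x r) = ENNReal.ofReal (v * r ^ (m + 1)))
    {S : Finset (Euc m)} {P b : ℝ} {e : Euc m} {d : Euc m → ℝ} (hP : 1 ≤ P)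
    (hS : ∀ x ∈ S, P / 2 ≤ ‖x‖ ∧ ‖x‖ ≤ P) (hsep : (S : Set (Euc m)).Pairwise Sep)
    (he : ‖e‖ = 1) (hPb : 1 ≤ P * b) (hbP : b ≤ P) (hd : ∀ x ∈ S, ∃ α : ℝ, ‖x - α • e‖ ≤ d x) :
    P ^ 2 * (v * (1 / (4 * P)) ^ (m + 1)) * ∑ x ∈ S, decay m (d x / b)
      ≤ 3 ^ (m + 2) * ((13 * P / b) * (I * b ^ (m + 1))) := by
  have hP0 : 0 < P := by linarith
  have hb : 0 < b := by
    by_contra! h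
    nlinarith
  have hd0 : ∀ x ∈ S, 0 ≤ d x := fun x hx => by
    obtain ⟨α, hα⟩ := hd x hx
    exact (norm_nonneg _).trans hα
  set N : ℕ := ⌈4 * P / b + 1⌉₊ with hN
  have hN1 : 4 * P / b + 1 ≤ N := Nat.le_ceil _
  have hN2 : (N : ℝ) < 4 * P / b + 1 + 1 := Nat.ceil_lt_add_one (by positivity)
  set K : ℕ := ⌊P ^ 2⌋₊ + 1 with hK
  have hK1 : P ^ 2 ≤ K := by
    have := (Nat.lt_floor_add_one (P ^ 2)).le
    rw [hK]; push_cast; exact this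
  have hθ : ∀ k ∈ Finset.range K, (k : ℝ) / P ^ 2 ≤ 1 := fun k hk => by
    rw [div_le_one (by positivity)]
    have : k ≤ ⌊P ^ 2⌋₊ := by rw [Finset.mem_range] at hk; omega
    exact (Nat.cast_le.2 this).trans (Nat.floor_le (by positivity))
  have hdisj := pairwiseDisjoint_tube_balls hP hS hsep K
  set V := v * (1 / (4 * P)) ^ (m + 1) with hV
  have hV0 : 0 < V := by positivity
  set B : Euc m × ℕ → Set (Euc m) :=
    fun p => Metric.ball ((1 + p.2 / P ^ 2) • p.1) (1 / (4 * P)) with hB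
  have key : ENNReal.ofReal (∑ p ∈ S ×ˢ Finset.range K, V * decay m (d p.1 / b))
      ≤ ENNReal.ofReal (3 ^ (m + 2) * ((2 * N + 1) * (I * b ^ (m + 1)))) := by
    rw [ENNReal.ofReal_sum_of_nonneg fun p hp => by
      have := decay_pos m (div_nonneg (hd0 p.1 (Finset.mem_product.1 hp).1) hb.le)
      positivity]
    have hstep : ∀ p ∈ S ×ˢ Finset.range K, ENNReal.ofReal (V * decay m (d p.1 / b))
        ≤ ∫⁻ x in B p, ENNReal.ofReal (3 ^ (m + 2)) * ENNReal.ofReal (tubeProfile m N b e x) := by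
      intro p hp
      rw [Finset.mem_product] at hp
      obtain ⟨α, hα⟩ := hd p.1 hp.1
      have : ∫⁻ _ in B p, ENNReal.ofReal (decay m (d p.1 / b))
          = ENNReal.ofReal (V * decay m (d p.1 / b)) := by
        rw [setLIntegral_const, hB, hv _ _ (by positivity), ← hV, mul_comm,
          ENNReal.ofReal_mul hV0.le]
      rw [← this]
      refine setLIntegral_mono ?_ fun x hx => ?_
      · exact (measurable_tubeProfile m N b e).ennreal_ofReal.const_mul _
      · rw [← ENNReal.ofReal_mul (by positivity)]
        refine ENNReal.ofReal_le_ofReal ?_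
        refine decay_le_tubeProfile hb hbP hPb he (hS p.1 hp.1).2 hα ?_ ?_ hx hN1
        · have : (0 : ℝ) ≤ p.2 / P ^ 2 := by positivity
          linarith
        · linarith [hθ p.2 hp.2]
    refine (Finset.sum_le_sum hstep).trans ?_
    rw [← lintegral_biUnion_finset hdisj fun p _ => measurableSet_ball]
    refine (setLIntegral_le_lintegral _ _).trans ?_
    rw [lintegral_const_mul _ (measurable_tubeProfile m N b e).ennreal_ofReal,
      ENNReal.ofReal_mul (by positivity)]
    gcongr
    exact lintegral_tubeProfile_le hb hI
  rw [ENNReal.ofReal_le_ofReal_iff (by positivity), Finset.sum_product] at key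
  simp only [Finset.sum_const, Finset.card_range, nsmul_eq_mul] at key
  have hsum0 : 0 ≤ ∑ x ∈ S, decay m (d x / b) :=
    Finset.sum_nonneg fun x hx => (decay_pos m (div_nonneg (hd0 x hx) hb.le)).le
  have hNb : (2 * N + 1 : ℝ) ≤ 13 * P / b := by
    have h1 : 1 ≤ P / b := (one_le_div hb).2 hbP
    have e1 : 4 * P / b = 4 * (P / b) := by ring
    have e2 : 13 * P / b = 13 * (P / b) := by ring
    rw [e2]; rw [e1] at hN2; linarith
  calc P ^ 2 * V * ∑ x ∈ S, decay m (d x / b)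
      ≤ K * V * ∑ x ∈ S, decay m (d x / b) := by gcongr
    _ = ∑ x ∈ S, K * (V * decay m (d x / b)) := by
        rw [Finset.mul_sum]; exact Finset.sum_congr rfl fun x _ => by ring
    _ ≤ _ := key
    _ ≤ _ := by gcongr

lemma exists_sum_decay_le (m : ℕ) :
    ∃ C : ℝ, 1 ≤ C ∧ ∀ (S : Finset (Euc m)) (P b : ℝ) (e : Euc m) (d : Euc m → ℝ), 1 ≤ P →
      (∀ x ∈ S, P / 2 ≤ ‖x‖ ∧ ‖x‖ ≤ P) → (S : Set (Euc m)).Pairwise Sep → ‖e‖ = 1 →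
      1 ≤ P * b → b ≤ P → (∀ x ∈ S, ∃ α : ℝ, ‖x - α • e‖ ≤ d x) →
      ∑ x ∈ S, decay m (d x / b) ≤ C * (P * b) ^ m := by
  obtain ⟨I, hI0, hI⟩ := exists_lintegral_decay_le m
  obtain ⟨v, hv0, hv⟩ := exists_volume_ball_eq m
  refine ⟨3 ^ (m + 2) * 13 * I * 4 ^ (m + 1) / v + 1, ?_, ?_⟩
  · have : 0 < 3 ^ (m + 2) * 13 * I * 4 ^ (m + 1) / v := by positivity
    linarith
  intro S P b e d hP hS hsep he hPb hbP hd
  have hP0 : 0 < P := by linarith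
  have hb : 0 < b := by
    by_contra! h
    nlinarith
  have h := sum_decay_mul_sq_le hI0 hI hv0 hv hP hS hsep he hPb hbP hd
  have h2 : ∑ x ∈ S, decay m (d x / b)
      ≤ (3 ^ (m + 2) * ((13 * P / b) * (I * b ^ (m + 1))))
        / (P ^ 2 * (v * (1 / (4 * P)) ^ (m + 1))) := by
    rw [le_div_iff₀ (by positivity)]
    linarith
  have h3 : (3 ^ (m + 2) * ((13 * P / b) * (I * b ^ (m + 1))))
        / (P ^ 2 * (v * (1 / (4 * P)) ^ (m + 1)))
      = 3 ^ (m + 2) * 13 * I * 4 ^ (m + 1) / v * (P * b) ^ m := by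
    rw [div_pow, one_pow, mul_pow, mul_pow]
    field_simp
    ring
  rw [h3] at h2
  have : 0 ≤ (P * b) ^ m := by positivity
  nlinarith

/-- A separated family in an annulus of radius `P` has `O(P ^ (2 * m))` members. -/
lemma exists_card_le (m : ℕ) :
    ∃ C : ℝ, 1 ≤ C ∧ ∀ (S : Finset (Euc m)) (P : ℝ), 1 ≤ P →
      (∀ x ∈ S, P / 2 ≤ ‖x‖ ∧ ‖x‖ ≤ P) → (S : Set (Euc m)).Pairwise Sep →
      (S.card : ℝ) ≤ C * (P ^ 2) ^ m := by
  obtain ⟨C, hC, h⟩ := exists_sum_decay_le m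
  refine ⟨2 ^ (m + 2) * C, ?_, fun S P hP hS hsep => ?_⟩
  · have : (1 : ℝ) ≤ 2 ^ (m + 2) := one_le_pow₀ (by norm_num)
    nlinarith
  have hP0 : 0 < P := by linarith
  have h1 := h S P P (EuclideanSpace.single 0 1) (fun x => ‖x‖) hP hS hsep (by simp)
    (by nlinarith) le_rfl (fun x _ => ⟨0, by simp⟩)
  have h2 : ∀ x ∈ S, (2 ^ (m + 2) : ℝ)⁻¹ ≤ decay m (‖x‖ / P) := fun x hx => by
    unfold decay
    have h3 : ‖x‖ / P ≤ 1 := (div_le_one hP0).2 (hS x hx).2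
    have h4 : 0 ≤ ‖x‖ / P := by positivity
    gcongr
    linarith
  have h5 := (Finset.sum_le_sum h2).trans h1
  rw [Finset.sum_const, nsmul_eq_mul, ← div_eq_mul_inv, div_le_iff₀ (by positivity)] at h5
  rw [pow_two]
  linarith

/-- The size of the kernel at the point `x` and parameter `r = e^{-t}`, measured against the
Gaussian volume of the cone below `x`. -/
noncomputable def coneTerm {m : ℕ} (r : ℝ) (x y : Euc m) : ℝ :=
  (r / (‖x‖ * √(1 - r ^ 2))) ^ m * exp (-(‖y - r • x‖ ^ 2 / (2 * (1 - r ^ 2))))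

lemma norm_sub_smul_eq {m : ℕ} {r : ℝ} (hr : 0 < r) (x y : Euc m) :
    ‖y - r • x‖ = r * ‖x - r⁻¹ • y‖ := by
  have : y - r • x = (-r) • (x - r⁻¹ • y) := by
    rw [smul_sub, smul_smul, neg_smul, neg_mul, mul_inv_cancel₀ hr.ne', neg_smul, one_smul]; abel
  rw [this, norm_smul, norm_neg, Real.norm_of_nonneg hr.le]

lemma one_sub_sq_pos {r : ℝ} (hr : 0 < r) (hr1 : r < 1) : 0 < 1 - r ^ 2 := by nlinarith

lemma one_le_norm_mul_sqrt {r ρ : ℝ} (hρ : 0 ≤ ρ) (h : 1 ≤ (1 - r ^ 2) * ρ ^ 2) :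
    1 ≤ ρ * √(1 - r ^ 2) := by
  have h2 : √1 ≤ √((1 - r ^ 2) * ρ ^ 2) := Real.sqrt_le_sqrt h
  rw [Real.sqrt_one, Real.sqrt_mul' _ (by positivity), Real.sqrt_sq hρ] at h2
  linarith

lemma coneTerm_factor_le_one {m : ℕ} {r : ℝ} {x : Euc m} (hr : 0 < r) (hr1 : r < 1)
    (h : 1 ≤ (1 - r ^ 2) * ‖x‖ ^ 2) : (r / (‖x‖ * √(1 - r ^ 2))) ^ m ≤ 1 := by
  have h1 := one_le_norm_mul_sqrt (norm_nonneg x) h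
  refine pow_le_one₀ (by positivity) ?_
  rw [div_le_one (by linarith)]
  linarith

lemma coneTerm_le_of_half_le {m : ℕ} {C P r : ℝ} {x y : Euc m}
    (hC : ∀ u : ℝ, 0 ≤ u → exp (-u) ≤ C * decay m u) (hC1 : 1 ≤ C) (hP : 1 ≤ P) (hr : 0 < r)
    (hr1 : r < 1) (h : 1 ≤ (1 - r ^ 2) * ‖x‖ ^ 2) (hx : P / 2 ≤ ‖x‖) (hr2 : 1 / 2 ≤ r)
    (hbad : (1 - r ^ 2) * ‖x‖ / 10 < ‖x - r⁻¹ • y‖) :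
    coneTerm r x y ≤ C * 160 ^ (m + 2) * decay m (‖x - r⁻¹ • y‖ / P⁻¹) := by
  have hs := one_sub_sq_pos hr hr1
  set d := ‖x - r⁻¹ • y‖ with hd
  have hd0 : 0 ≤ d := norm_nonneg _
  have hz : P * d / 160 ≤ ‖y - r • x‖ ^ 2 / (2 * (1 - r ^ 2)) := by
    rw [norm_sub_smul_eq hr, ← hd, le_div_iff₀ (by positivity)]
    have h1 : (1 - r ^ 2) * ‖x‖ / 10 * d ≤ d ^ 2 := by nlinarith
    have h2 : (1 / 2) ^ 2 ≤ r ^ 2 := by gcongr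
    have h3 : (1 - r ^ 2) * (P / 2) * d ≤ (1 - r ^ 2) * ‖x‖ * d := by gcongr
    have h4 : (1 / 2) ^ 2 * d ^ 2 ≤ r ^ 2 * d ^ 2 := by gcongr
    rw [mul_pow]
    linarith
  have hd1 : d / P⁻¹ = P * d := by rw [div_inv_eq_mul, mul_comm]
  have h0 : 0 ≤ P * d := by positivity
  calc coneTerm r x y ≤ 1 * exp (-(P * d / 160)) := by
        unfold coneTerm
        have := coneTerm_factor_le_one hr hr1 h
        gcongr
    _ ≤ C * decay m (P * d / 160) := by rw [one_mul]; exact hC _ (by positivity)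
    _ ≤ C * (160 ^ (m + 2) * decay m (P * d)) := by
        gcongr
        exact decay_le_mul_decay m (by positivity) h0 (by norm_num) (by linarith)
    _ = _ := by rw [hd1]; ring

lemma pow_mul_decay_sq_le (m : ℕ) {u : ℝ} (hu : 0 ≤ u) : u ^ m * decay m (u ^ 2) ≤ 1 := by
  unfold decay
  rw [← div_eq_mul_inv, div_le_one (by positivity)]
  calc u ^ m ≤ (1 + u ^ 2) ^ m := by
        gcongr
        nlinarith [sq_nonneg (u - 1)]
    _ ≤ (1 + u ^ 2) ^ (m + 2) := pow_le_pow_right₀ (by nlinarith) (by omega)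

lemma coneTerm_le_of_lt_half {m : ℕ} {C P r : ℝ} {x y : Euc m}
    (hC : ∀ u : ℝ, 0 ≤ u → exp (-u) ≤ C * decay m u) (hC1 : 1 ≤ C) (hP : 1 ≤ P) (hr : 0 < r)
    (hx : P / 2 ≤ ‖x‖) (hr2 : r < 1 / 2)
    (hbad : (1 - r ^ 2) * ‖x‖ / 10 < ‖x - r⁻¹ • y‖) :
    coneTerm r x y ≤ C * 300 ^ (m + 2) * 8 ^ m * ((P ^ 2) ^ m)⁻¹ := by
  have hs := one_sub_sq_pos hr (by linarith)
  have hx0 : 0 < ‖x‖ := by linarith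
  set u := r * ‖x‖ with hu
  have hu0 : 0 < u := by positivity
  have hs34 : 3 / 4 ≤ 1 - r ^ 2 := by nlinarith
  have hσ : 1 / 2 ≤ √(1 - r ^ 2) := Real.le_sqrt_of_sq_le (by linarith)
  have hz : u ^ 2 / 300 ≤ ‖y - r • x‖ ^ 2 / (2 * (1 - r ^ 2)) := by
    rw [norm_sub_smul_eq hr, le_div_iff₀ (by positivity), mul_pow, mul_pow]
    have h1 : ((1 - r ^ 2) * ‖x‖ / 10) ^ 2 ≤ ‖x - r⁻¹ • y‖ ^ 2 := by gcongr
    have h2 : r ^ 2 * ((1 - r ^ 2) * ‖x‖ / 10) ^ 2 ≤ r ^ 2 * ‖x - r⁻¹ • y‖ ^ 2 := by gcongr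
    have h3 : 3 / 4 * (1 - r ^ 2) * (r ^ 2 * ‖x‖ ^ 2)
        ≤ (1 - r ^ 2) * (1 - r ^ 2) * (r ^ 2 * ‖x‖ ^ 2) := by gcongr
    have h4 : 0 ≤ (1 - r ^ 2) * (r ^ 2 * ‖x‖ ^ 2) := by positivity
    linarith
  have hfac : r / (‖x‖ * √(1 - r ^ 2)) ≤ 8 * (P ^ 2)⁻¹ * u := by
    rw [div_le_iff₀ (by positivity)]
    have h1 : P ^ 2 ≤ 4 * ‖x‖ ^ 2 := by nlinarith
    calc r = 8 * (P ^ 2)⁻¹ * r * (P ^ 2 / 8) := by field_simp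
      _ ≤ 8 * (P ^ 2)⁻¹ * r * (‖x‖ * ‖x‖ * (1 / 2)) := by gcongr; linarith
      _ ≤ 8 * (P ^ 2)⁻¹ * r * (‖x‖ * ‖x‖ * √(1 - r ^ 2)) := by gcongr
      _ = _ := by rw [hu]; ring
  calc coneTerm r x y ≤ (8 * (P ^ 2)⁻¹ * u) ^ m * exp (-(u ^ 2 / 300)) := by
        unfold coneTerm
        gcongr
    _ ≤ (8 * (P ^ 2)⁻¹ * u) ^ m * (C * (300 ^ (m + 2) * decay m (u ^ 2))) := by
        gcongr
        refine (hC _ (by positivity)).trans ?_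
        gcongr
        exact decay_le_mul_decay m (by positivity) (by positivity) (by norm_num) (by nlinarith)
    _ = C * 300 ^ (m + 2) * 8 ^ m * ((P ^ 2) ^ m)⁻¹ * (u ^ m * decay m (u ^ 2)) := by
        rw [mul_pow, mul_pow, inv_pow]; ring
    _ ≤ C * 300 ^ (m + 2) * 8 ^ m * ((P ^ 2) ^ m)⁻¹ * 1 := by
        have := pow_mul_decay_sq_le m hu0.le
        gcongr
    _ = _ := mul_one _

lemma abs_norm_div_sub_norm_le {m : ℕ} {r : ℝ} {x y : Euc m} (hr : 0 < r)
    (h : ‖x - r⁻¹ • y‖ ≤ (1 - r ^ 2) * ‖x‖ / 10) :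
    |‖y‖ / r - ‖x‖| ≤ (1 - r ^ 2) * ‖x‖ / 10 := by
  refine le_trans ?_ h
  have := abs_norm_sub_norm_le x (r⁻¹ • y)
  rwa [norm_smul, Real.norm_of_nonneg (by positivity), inv_mul_eq_div, abs_sub_comm] at this

lemma le_mul_of_close {m : ℕ} {r r' : ℝ} {x x' y : Euc m} (hr : 0 < r) (hr' : 0 < r')
    (hx : 0 < ‖x‖) (hxx : ‖x'‖ ≤ 2 * ‖x‖)
    (h : ‖x - r⁻¹ • y‖ ≤ (1 - r ^ 2) * ‖x‖ / 10)
    (h' : ‖x' - r'⁻¹ • y‖ ≤ (1 - r' ^ 2) * ‖x'‖ / 10) : r ≤ 4 * r' := by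
  have a := abs_le.1 (abs_norm_div_sub_norm_le hr h)
  have b := abs_le.1 (abs_norm_div_sub_norm_le hr' h')
  have a1 : 9 / 10 * ‖x‖ ≤ ‖y‖ / r := by nlinarith [mul_nonneg (sq_nonneg r) hx.le]
  have b1 : ‖y‖ / r' ≤ 11 / 10 * ‖x'‖ := by nlinarith [mul_nonneg (sq_nonneg r') (norm_nonneg x')]
  rw [le_div_iff₀ hr] at a1
  rw [div_le_iff₀ hr'] at b1
  by_contra! hc
  have : 11 / 10 * ‖x'‖ * r' ≤ 11 / 10 * (2 * ‖x‖) * r' := by gcongr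
  nlinarith

lemma mul_sq_le_sub_sq_of_close {ρ ρ' r r' s s' Y : ℝ} (hs : 0 < s) (hs' : 0 < s') (hs1 : s < 1)
    (hr' : 0 < r') (hρ' : 0 < ρ') (hρρ : ρ' ≤ 2 * ρ)
    (hr2 : r ^ 2 = 1 - s) (hr2' : r' ^ 2 = 1 - s') (hlt : 16 * s' < s)
    (a1 : Y ≤ ρ * (1 + s / 10) * r) (b1 : ρ' * (1 - s' / 10) * r' ≤ Y) :
    4 / 10 * (s * ρ ^ 2) ≤ ρ ^ 2 - ρ' ^ 2 := by
  have hsq : (ρ' * (1 - s' / 10) * r') ^ 2 ≤ (ρ * (1 + s / 10) * r) ^ 2 := by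
    have : 0 ≤ ρ' * (1 - s' / 10) * r' :=
      mul_nonneg (mul_nonneg hρ'.le (by linarith)) hr'.le
    exact pow_le_pow_left₀ this (b1.trans a1) 2
  rw [mul_pow, mul_pow, mul_pow, mul_pow, hr2, hr2'] at hsq
  have c1 : (1 + s / 10) ^ 2 * (1 - s) ≤ 1 - 79 / 100 * s := by
    have h1 : 0 ≤ s ^ 2 := sq_nonneg s
    have h2 : 0 ≤ s ^ 3 := by positivity
    have h3 : (1 + s / 10) ^ 2 * (1 - s) = 1 - 8 / 10 * s - 19 / 100 * s ^ 2 - s ^ 3 / 100 := by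
      ring
    linarith
  have c2 : 1 - 12 / 10 * s' ≤ (1 - s' / 10) ^ 2 * (1 - s') := by
    have h2 : 0 ≤ s' ^ 2 * (1 - s') := mul_nonneg (sq_nonneg _) (by linarith)
    have h1 : 0 ≤ s' ^ 2 := sq_nonneg s'
    have h3 : (1 - s' / 10) ^ 2 * (1 - s') - (1 - 12 / 10 * s')
      = 20 / 100 * s' ^ 2 + 1 / 100 * (s' ^ 2 * (1 - s')) := by ring
    linarith
  have d1 : ρ' ^ 2 * (1 - 12 / 10 * s') ≤ ρ ^ 2 * (1 - 79 / 100 * s) := by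
    calc _ ≤ ρ' ^ 2 * ((1 - s' / 10) ^ 2 * (1 - s')) :=
          mul_le_mul_of_nonneg_left c2 (sq_nonneg _)
      _ ≤ ρ ^ 2 * ((1 + s / 10) ^ 2 * (1 - s)) := by linarith
      _ ≤ _ := mul_le_mul_of_nonneg_left c1 (sq_nonneg _)
  have d2 : s' * ρ' ^ 2 ≤ s / 16 * (2 * ρ) ^ 2 := by
    have : ρ' ^ 2 ≤ (2 * ρ) ^ 2 := pow_le_pow_left₀ hρ'.le hρρ 2
    exact mul_le_mul (by linarith) this (sq_nonneg _) (by linarith)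
  have : 0 ≤ s * ρ ^ 2 := by positivity
  linarith

lemma one_sub_sq_le_of_close {m : ℕ} {r r' : ℝ} {x x' y : Euc m} (hr : 0 < r) (hr1 : r < 1)
    (hr' : 0 < r') (hr1' : r' < 1) (hx : 0 < ‖x‖) (hx' : 0 < ‖x'‖) (hxx : ‖x'‖ ≤ 2 * ‖x‖)
    (h : ‖x - r⁻¹ • y‖ ≤ (1 - r ^ 2) * ‖x‖ / 10)
    (h' : ‖x' - r'⁻¹ • y‖ ≤ (1 - r' ^ 2) * ‖x'‖ / 10) (hsep : Sep x x') :
    1 - r ^ 2 ≤ 16 * (1 - r' ^ 2) := by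
  have hs := one_sub_sq_pos hr hr1
  have hs' := one_sub_sq_pos hr' hr1'
  have a := abs_le.1 (abs_norm_div_sub_norm_le hr h)
  have b := abs_le.1 (abs_norm_div_sub_norm_le hr' h')
  by_contra! hlt
  set s := 1 - r ^ 2 with hsdef
  set s' := 1 - r' ^ 2 with hsdef'
  have hs1 : s < 1 := by nlinarith
  have hs1' : s' < 1 := by nlinarith
  set ρ := ‖x‖
  set ρ' := ‖x'‖
  have a1 : ‖y‖ ≤ ρ * (1 + s / 10) * r := by
    rw [← div_le_iff₀ hr]; linarith
  have b1 : ρ' * (1 - s' / 10) * r' ≤ ‖y‖ := by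
    rw [← le_div_iff₀ hr']; linarith
  have hr2 : r ^ 2 = 1 - s := by rw [hsdef]; ring
  have hr2' : r' ^ 2 = 1 - s' := by rw [hsdef']; ring
  have d3 : 4 / 10 * (s * ρ ^ 2) ≤ ρ ^ 2 - ρ' ^ 2 :=
    mul_sq_le_sub_sq_of_close hs hs' hs1 hr' hx' hxx hr2 hr2' hlt a1 b1
  have hlt' : ρ' ≤ ρ := by
    have : 0 ≤ s * ρ ^ 2 := by positivity
    exact le_of_sq_le_sq (by linarith) hx.le
  have e1 : ‖x - x'‖ ≤ s * ρ / 10 + (s' * ρ' / 10 + (ρ - ρ' + s * ρ / 10 + s' * ρ' / 10)) := by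
    have t1 : x - x' = (x - r⁻¹ • y) - (x' - r'⁻¹ • y) + (r⁻¹ - r'⁻¹) • y := by
      rw [sub_smul]; abel
    have t2 : ‖(r⁻¹ - r'⁻¹) • y‖ = |‖y‖ / r - ‖y‖ / r'| := by
      rw [norm_smul, Real.norm_eq_abs, ← abs_of_nonneg (norm_nonneg y), ← abs_mul,
        abs_of_nonneg (norm_nonneg y)]
      ring_nf
    have t3 : |‖y‖ / r - ‖y‖ / r'| ≤ ρ - ρ' + s * ρ / 10 + s' * ρ' / 10 := by
      rw [abs_le]
      constructor <;> linarith
    rw [t1]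
    refine (norm_add_le _ _).trans ?_
    have := norm_sub_le (x - r⁻¹ • y) (x' - r'⁻¹ • y)
    linarith
  have e2 : s' * ρ' ≤ s / 16 * (2 * ρ) := by
    gcongr
    linarith
  have e3 : ‖x - x'‖ ≤ (ρ - ρ') + 225 / 1000 * (s * ρ) := by linarith
  have e4 : ρ * ‖x - x'‖ ≤ ρ * ((ρ - ρ') + 225 / 1000 * (s * ρ)) := by gcongr
  unfold Sep at hsep
  have hmax : max ‖x‖ ‖x'‖ = ρ := max_eq_left hlt'
  rw [hmax] at hsep
  have habs := le_abs_self (‖x‖ ^ 2 - ‖x'‖ ^ 2)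
  have e5 : ρ * (ρ - ρ') ≤ ρ ^ 2 - ρ' ^ 2 := by
    linarith [mul_nonneg hx'.le (sub_nonneg.2 hlt')]
  change _ < ρ * ‖x - x'‖ at hsep
  change ρ ^ 2 - ρ' ^ 2 ≤ _ at habs
  have e6 : 0 ≤ s * ρ ^ 2 := by positivity
  have e7 : ρ * ((ρ - ρ') + 225 / 1000 * (s * ρ)) = ρ * (ρ - ρ') + 225 / 1000 * (s * ρ ^ 2) := by
    ring
  linarith

lemma exp_neg_sq_div_two_le (u : ℝ) : exp (-(u ^ 2 / 2)) ≤ exp (1 / 2) * exp (-u) := by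
  rw [← Real.exp_add]
  exact Real.exp_le_exp.2 (by linarith [sq_nonneg (u - 1)])

lemma coneTerm_le_of_comparable {m : ℕ} {C P r b : ℝ} {x y : Euc m}
    (hC : ∀ u : ℝ, 0 ≤ u → exp (-u) ≤ C * decay m u) (hP : 0 < P) (hr : 0 < r)
    (hr1 : r < 1) (hx : P / 2 ≤ ‖x‖) (hb : 0 < b) (hb1 : √(1 - r ^ 2) / r ≤ b)
    (hb2 : b ≤ 256 * (√(1 - r ^ 2) / r)) :
    coneTerm r x y ≤ (512 / (P * b)) ^ m * (exp (1 / 2) * C) * decay m (‖x - r⁻¹ • y‖ / b) := by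
  have hs := one_sub_sq_pos hr hr1
  set s := 1 - r ^ 2
  have hσ : 0 < √s := Real.sqrt_pos.2 hs
  have hx0 : 0 < ‖x‖ := by linarith
  set d := ‖x - r⁻¹ • y‖ with hd
  have h1 : r / (‖x‖ * √s) ≤ 512 / (P * b) := by
    rw [div_le_div_iff₀ (by positivity) (by positivity)]
    calc r * (P * b) ≤ r * ((2 * ‖x‖) * (256 * (√s / r))) := by gcongr; linarith
      _ = _ := by field_simp; norm_num
  have h2 : (d / b) ^ 2 / 2 ≤ ‖y - r • x‖ ^ 2 / (2 * s) := by
    rw [norm_sub_smul_eq hr, ← hd]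
    calc (d / b) ^ 2 / 2 ≤ (d / (√s / r)) ^ 2 / 2 := by gcongr
      _ = (r * d) ^ 2 / (2 * √s ^ 2) := by field_simp
      _ = _ := by rw [Real.sq_sqrt hs.le]
  calc coneTerm r x y ≤ (512 / (P * b)) ^ m * exp (-((d / b) ^ 2 / 2)) := by
        unfold coneTerm
        gcongr
    _ ≤ (512 / (P * b)) ^ m * (exp (1 / 2) * (C * decay m (d / b))) := by
        gcongr
        refine (exp_neg_sq_div_two_le _).trans ?_
        gcongr
        exact hC _ (by positivity)
    _ = _ := by ring

lemma sq_le_two_mul_sq_of_sep {m : ℕ} {a b : Euc m} (h : Sep a b) : ‖b‖ ^ 2 ≤ 2 * ‖a‖ ^ 2 := by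
  unfold Sep at h
  by_contra! hlt
  have hab : ‖a‖ ≤ ‖b‖ := by
    refine le_of_sq_le_sq ?_ (norm_nonneg _)
    nlinarith [sq_nonneg ‖a‖]
  rw [max_eq_right hab, abs_sub_comm] at h
  have h1 := le_abs_self (‖b‖ ^ 2 - ‖a‖ ^ 2)
  have h2 : ‖b‖ * ‖a - b‖ ≤ ‖b‖ * (‖b‖ + ‖b‖) := by
    gcongr
    exact (norm_sub_le _ _).trans (by linarith)
  nlinarith

lemma exists_annulus_of_sep {m : ℕ} {S : Finset (Euc m)} (hS : S.Nonempty)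
    (hsep : (S : Set (Euc m)).Pairwise Sep) :
    ∃ P : ℝ, (∃ x ∈ S, ‖x‖ = P) ∧ ∀ x ∈ S, P / 2 ≤ ‖x‖ ∧ ‖x‖ ≤ P := by
  obtain ⟨z, hz, hmax⟩ := S.exists_max_image (fun x => ‖x‖) hS
  refine ⟨‖z‖, ⟨z, hz, rfl⟩, fun x hx => ⟨?_, hmax x hx⟩⟩
  by_cases hxz : x = z
  · rw [hxz]; linarith [norm_nonneg z]
  · have := sq_le_two_mul_sq_of_sep (hsep hx hz hxz)
    refine le_of_sq_le_sq ?_ (norm_nonneg _)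
    nlinarith [sq_nonneg ‖x‖]

lemma exists_unit_direction {m : ℕ} (y : Euc m) : ∃ e : Euc m, ‖e‖ = 1 ∧ y = ‖y‖ • e := by
  by_cases hy : y = 0
  · exact ⟨EuclideanSpace.single 0 1, by simp, by simp [hy]⟩
  · refine ⟨‖y‖⁻¹ • y, by rw [norm_smul, norm_inv, norm_norm, inv_mul_cancel₀ (norm_ne_zero_iff.2 hy)], ?_⟩
    rw [smul_smul, mul_inv_cancel₀ (norm_ne_zero_iff.2 hy), one_smul]

lemma sqrt_div_le_of_close {m : ℕ} {r r' : ℝ} {x x' y : Euc m} (hr : 0 < r) (hr1 : r < 1)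
    (hr' : 0 < r') (hr1' : r' < 1) (hx : 0 < ‖x‖) (hx' : 0 < ‖x'‖) (hxx : ‖x'‖ ≤ 2 * ‖x‖)
    (hxx' : ‖x‖ ≤ 2 * ‖x'‖) (h : ‖x - r⁻¹ • y‖ ≤ (1 - r ^ 2) * ‖x‖ / 10)
    (h' : ‖x' - r'⁻¹ • y‖ ≤ (1 - r' ^ 2) * ‖x'‖ / 10) (hsep : Sep x x') :
    √(1 - r ^ 2) / r ≤ 16 * (√(1 - r' ^ 2) / r') := by
  have h1 := one_sub_sq_le_of_close hr hr1 hr' hr1' hx hx' hxx h h' hsep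
  have h2 := le_mul_of_close hr' hr hx' hxx' h' h
  have h3 : √(1 - r ^ 2) ≤ 4 * √(1 - r' ^ 2) := by
    have : √(1 - r ^ 2) ≤ √(4 ^ 2 * (1 - r' ^ 2)) := Real.sqrt_le_sqrt (by linarith)
    rwa [Real.sqrt_mul (by norm_num), Real.sqrt_sq (by norm_num)] at this
  rw [div_le_iff₀ hr]
  calc √(1 - r ^ 2) ≤ 4 * √(1 - r' ^ 2) := h3
    _ = 16 * (√(1 - r' ^ 2) / r') * (r' / 4) := by field_simp; ring
    _ ≤ _ := by gcongr; linarith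

lemma exists_sum_coneTerm_close_le (m : ℕ) :
    ∃ C : ℝ, 1 ≤ C ∧ ∀ (S : Finset (Euc m)) (P : ℝ) (r : Euc m → ℝ) (y : Euc m), 1 ≤ P →
      (∀ x ∈ S, P / 2 ≤ ‖x‖ ∧ ‖x‖ ≤ P) → (S : Set (Euc m)).Pairwise Sep →
      (∀ x ∈ S, 0 < r x ∧ r x < 1 ∧ 1 ≤ (1 - r x ^ 2) * ‖x‖ ^ 2) →
      (∀ x ∈ S, ‖x - (r x)⁻¹ • y‖ ≤ (1 - r x ^ 2) * ‖x‖ / 10) →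
      ∑ x ∈ S, coneTerm (r x) x y ≤ C := by
  obtain ⟨C₀, hC₀, hexp⟩ := exists_exp_neg_le_decay m
  obtain ⟨C₁, hC₁, hsum⟩ := exists_sum_decay_le m
  obtain ⟨C₂, hC₂, hcard⟩ := exists_card_le m
  have hA0 : (1 : ℝ) ≤ 512 ^ m * (exp (1 / 2) * C₀) :=
    one_le_mul_of_one_le_of_one_le (one_le_pow₀ (by norm_num))
      (one_le_mul_of_one_le_of_one_le (Real.one_le_exp (by norm_num)) hC₀)
  set A := 512 ^ m * (exp (1 / 2) * C₀) with hA
  refine ⟨A * (C₁ + C₂), one_le_mul_of_one_le_of_one_le hA0 (by linarith),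
    fun S P r y hP hS hsep hr hclose => ?_⟩
  rcases S.eq_empty_or_nonempty with rfl | ⟨z, hz⟩
  · simp only [Finset.sum_empty]
    nlinarith
  have hpos : ∀ x ∈ S, 0 < ‖x‖ := fun x hx => by linarith [(hS x hx).1]
  set b : Euc m → ℝ := fun x => √(1 - r x ^ 2) / r x with hb
  have hbpos : ∀ x ∈ S, 0 < b x := fun x hx =>
    div_pos (Real.sqrt_pos.2 (one_sub_sq_pos (hr x hx).1 (hr x hx).2.1)) (hr x hx).1
  have hcomp : ∀ x ∈ S, ∀ x' ∈ S, b x ≤ 16 * b x' := fun x hx x' hx' => by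
    by_cases hxx : x = x'
    · subst hxx; linarith [hbpos x hx]
    · exact sqrt_div_le_of_close (hr x hx).1 (hr x hx).2.1 (hr x' hx').1 (hr x' hx').2.1
        (hpos x hx) (hpos x' hx') (by linarith [(hS x hx).1, (hS x' hx').2])
        (by linarith [(hS x' hx').1, (hS x hx).2]) (hclose x hx) (hclose x' hx')
        (hsep hx hx' hxx)
  set B := 16 * b z with hB
  have hB0 : 0 < B := by linarith [hbpos z hz]
  have hPB : 1 ≤ P * B := by
    have h1 := one_le_norm_mul_sqrt (norm_nonneg z) (hr z hz).2.2
    have h2 : √(1 - r z ^ 2) ≤ b z := by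
      rw [hb, le_div_iff₀ (hr z hz).1]
      nlinarith [Real.sqrt_nonneg (1 - r z ^ 2), (hr z hz).2.1]
    have h3 : ‖z‖ * √(1 - r z ^ 2) ≤ P * b z :=
      mul_le_mul (hS z hz).2 h2 (Real.sqrt_nonneg _) (by linarith)
    have := mul_pos (by linarith : 0 < P) (hbpos z hz)
    rw [hB]; linarith
  have hterm : ∀ x ∈ S,
      coneTerm (r x) x y ≤ A / (P * B) ^ m * decay m (‖x - (r x)⁻¹ • y‖ / B) := fun x hx => by
    refine (coneTerm_le_of_comparable hexp (by linarith) (hr x hx).1 (hr x hx).2.1 (hS x hx).1 hB0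
      (hcomp x hx z hz) ?_).trans (le_of_eq ?_)
    · rw [hB]
      linarith [hcomp z hz x hx]
    · rw [div_pow, hA]; ring
  have hPBm : 0 < (P * B) ^ m := by positivity
  refine (Finset.sum_le_sum hterm).trans ?_
  rw [← Finset.mul_sum, div_mul_eq_mul_div, div_le_iff₀ hPBm, mul_assoc A (C₁ + C₂)]
  refine mul_le_mul_of_nonneg_left ?_ (zero_le_one.trans hA0)
  rcases le_or_gt B P with hBP | hBP
  · obtain ⟨e, he, hy⟩ := exists_unit_direction y
    refine (hsum S P B e _ hP hS hsep he hPB hBP fun x hx => ?_).trans ?_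
    · refine ⟨(r x)⁻¹ * ‖y‖, le_of_eq ?_⟩
      rw [mul_smul, ← hy]
    · gcongr
      linarith
  · calc ∑ x ∈ S, decay m (‖x - (r x)⁻¹ • y‖ / B) ≤ ∑ x ∈ S, 1 :=
          Finset.sum_le_sum fun x _ => decay_le_one m (by positivity)
      _ = S.card := by simp
      _ ≤ C₂ * (P ^ 2) ^ m := hcard S P hP hS hsep
      _ ≤ (C₁ + C₂) * (P * B) ^ m := by
        rw [sq]
        gcongr
        linarith

theorem exists_sum_coneTerm_le (m : ℕ) :
    ∃ C : ℝ, 1 ≤ C ∧ ∀ (S : Finset (Euc m)) (r : Euc m → ℝ),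
      (∀ x ∈ S, 0 < r x ∧ r x < 1 ∧ 1 ≤ (1 - r x ^ 2) * ‖x‖ ^ 2) →
      (S : Set (Euc m)).Pairwise Sep → ∀ y, ∑ x ∈ S, coneTerm (r x) x y ≤ C := by
  classical
  obtain ⟨C₀, hC₀, hexp⟩ := exists_exp_neg_le_decay m
  obtain ⟨C₁, hC₁, hsum⟩ := exists_sum_decay_le m
  obtain ⟨C₂, hC₂, hcard⟩ := exists_card_le m
  obtain ⟨C₃, hC₃, hclose⟩ := exists_sum_coneTerm_close_le m
  have hA : 0 ≤ C₀ * 160 ^ (m + 2) * C₁ := by positivity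
  have hB : 0 ≤ C₀ * 300 ^ (m + 2) * 8 ^ m * C₂ := by positivity
  refine ⟨C₃ + (C₀ * 160 ^ (m + 2) * C₁ + C₀ * 300 ^ (m + 2) * 8 ^ m * C₂), by linarith,
    fun S r hr hsep y => ?_⟩
  rcases S.eq_empty_or_nonempty with rfl | hne
  · simp only [Finset.sum_empty]
    linarith
  obtain ⟨P, ⟨z, hz, hzP⟩, hS⟩ := exists_annulus_of_sep hne hsep
  have hP : 1 ≤ P := by
    have h1 := one_le_norm_mul_sqrt (norm_nonneg z) (hr z hz).2.2
    have h2 : √(1 - r z ^ 2) ≤ 1 := Real.sqrt_le_one.2 (by linarith [sq_nonneg (r z)])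
    rw [← hzP]
    nlinarith [norm_nonneg z]
  rw [← Finset.sum_filter_add_sum_filter_not S
    (fun x => ‖x - (r x)⁻¹ • y‖ ≤ (1 - r x ^ 2) * ‖x‖ / 10)]
  have hmono : ∀ (p : Euc m → Prop) [DecidablePred p],
      ((S.filter p : Finset (Euc m)) : Set (Euc m)).Pairwise Sep := fun p _ =>
    hsep.mono (Finset.coe_subset.2 (Finset.filter_subset p S))
  refine add_le_add (hclose _ P r y hP (fun x hx => hS x (Finset.mem_filter.1 hx).1) (hmono _)
    (fun x hx => hr x (Finset.mem_filter.1 hx).1) fun x hx => (Finset.mem_filter.1 hx).2) ?_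
  set T := S.filter fun x => ¬ ‖x - (r x)⁻¹ • y‖ ≤ (1 - r x ^ 2) * ‖x‖ / 10 with hT
  have hTS : ∀ x ∈ T, x ∈ S := fun x hx => (Finset.mem_filter.1 hx).1
  have hTsep : (T : Set (Euc m)).Pairwise Sep := hmono _
  have hbad : ∀ x ∈ T, (1 - r x ^ 2) * ‖x‖ / 10 < ‖x - (r x)⁻¹ • y‖ := fun x hx =>
    not_le.1 (Finset.mem_filter.1 hx).2
  have hT2 : ∀ (p : Euc m → Prop) [DecidablePred p],
      ((T.filter p : Finset (Euc m)) : Set (Euc m)).Pairwise Sep := fun p _ =>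
    hTsep.mono (Finset.coe_subset.2 (Finset.filter_subset p T))
  rw [← Finset.sum_filter_add_sum_filter_not T (fun x => 1 / 2 ≤ r x)]
  refine add_le_add ?_ ?_
  · obtain ⟨e, he, hy⟩ := exists_unit_direction y
    have h1 := hsum (T.filter fun x => 1 / 2 ≤ r x) P P⁻¹ e (fun x => ‖x - (r x)⁻¹ • y‖) hP
      (fun x hx => hS x (hTS x (Finset.mem_filter.1 hx).1)) (hT2 _) he
      (by rw [mul_inv_cancel₀ (by linarith)]) ((inv_le_one_of_one_le₀ hP).trans hP)
      (fun x _ => ⟨(r x)⁻¹ * ‖y‖, le_of_eq (by rw [mul_smul, ← hy])⟩)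
    rw [mul_inv_cancel₀ (by linarith), one_pow, mul_one] at h1
    refine le_trans (Finset.sum_le_sum fun x hx => ?_)
      ((Finset.mul_sum _ _ _).symm.trans_le (mul_le_mul_of_nonneg_left h1 (by positivity)))
    obtain ⟨hxT, hx2⟩ := Finset.mem_filter.1 hx
    have hxr := hr x (hTS x hxT)
    exact coneTerm_le_of_half_le hexp hC₀ hP hxr.1 hxr.2.1 hxr.2.2 (hS x (hTS x hxT)).1 hx2
      (hbad x hxT)
  · have h1 := hcard (T.filter fun x => ¬ 1 / 2 ≤ r x) P hP
      (fun x hx => hS x (hTS x (Finset.mem_filter.1 hx).1)) (hT2 _)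
    have hPm : 0 < (P ^ 2) ^ m := by positivity
    calc _ ≤ ∑ x ∈ T.filter fun x => ¬ 1 / 2 ≤ r x,
            C₀ * 300 ^ (m + 2) * 8 ^ m * ((P ^ 2) ^ m)⁻¹ := Finset.sum_le_sum fun x hx => by
          obtain ⟨hxT, hx2⟩ := Finset.mem_filter.1 hx
          have hxr := hr x (hTS x hxT)
          exact coneTerm_le_of_lt_half hexp hC₀ hP hxr.1 (hS x (hTS x hxT)).1 (not_le.1 hx2)
            (hbad x hxT)
      _ = C₀ * 300 ^ (m + 2) * 8 ^ m * ((P ^ 2) ^ m)⁻¹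
            * (T.filter fun x => ¬ 1 / 2 ≤ r x).card := by
          rw [Finset.sum_const, nsmul_eq_mul, mul_comm]
      _ ≤ C₀ * 300 ^ (m + 2) * 8 ^ m * ((P ^ 2) ^ m)⁻¹ * (C₂ * (P ^ 2) ^ m) := by gcongr
      _ = _ := by field_simp

/-- The inverse Gaussian measure on `Euc m`, without its normalising constant. -/
noncomputable def invGauss (m : ℕ) : Measure (Euc m) :=
  volume.withDensity fun x => ENNReal.ofReal (exp (‖x‖ ^ 2))

/-- The points that are absorbed by `b` in the covering argument. -/
def zone {m : ℕ} (b : Euc m) : Set (Euc m) := {a | ‖a‖ ^ 2 ≤ ‖b‖ ^ 2 + 1 ∧ ¬ Sep a b}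

lemma measurableSet_zone {m : ℕ} (b : Euc m) : MeasurableSet (zone b) := by
  have h : zone b = {a : Euc m | ‖a‖ ^ 2 ≤ ‖b‖ ^ 2 + 1} ∩
      {a : Euc m | max ‖a‖ ‖b‖ * ‖a - b‖ ≤ 1 + 4 * |‖a‖ ^ 2 - ‖b‖ ^ 2|} := by
    ext a
    simp [zone, Sep]
  rw [h]
  refine (measurableSet_le (by fun_prop) (by fun_prop)).inter (measurableSet_le ?_ ?_)
  · exact ((measurable_norm.max measurable_const).mul (by fun_prop))
  · exact (Continuous.measurable (by fun_prop))

lemma exp_norm_sq_le_of_mem_zone {m : ℕ} {C : ℝ} {a b : Euc m}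
    (hC : ∀ u : ℝ, 0 ≤ u → exp (-u) ≤ C * decay m u) (hC1 : 1 ≤ C) (h : a ∈ zone b) :
    exp (‖a‖ ^ 2) ≤ exp 2 * C * 4 ^ (m + 2) * exp (‖b‖ ^ 2) * decay m (‖b‖ * ‖a - b‖) := by
  obtain ⟨h1, h2⟩ := h
  unfold Sep at h2
  push Not at h2
  set τ := |‖a‖ ^ 2 - ‖b‖ ^ 2| with hτ
  have hτ0 : 0 ≤ τ := abs_nonneg _
  have h3 : ‖a‖ ^ 2 ≤ 2 + (-τ + ‖b‖ ^ 2) := by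
    rcases abs_cases (‖a‖ ^ 2 - ‖b‖ ^ 2) with h | h <;> rw [← hτ] at h <;> linarith
  have h4 : ‖b‖ * ‖a - b‖ ≤ 1 + 4 * τ := le_trans (by gcongr; exact le_max_right _ _) h2
  calc exp (‖a‖ ^ 2) ≤ exp (2 + (-τ + ‖b‖ ^ 2)) := Real.exp_le_exp.2 h3
    _ = exp 2 * (exp (-τ) * exp (‖b‖ ^ 2)) := by rw [Real.exp_add, Real.exp_add]
    _ ≤ exp 2 * (C * (4 ^ (m + 2) * decay m (‖b‖ * ‖a - b‖)) * exp (‖b‖ ^ 2)) := by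
        gcongr
        refine (hC τ hτ0).trans ?_
        gcongr
        exact decay_le_mul_decay m hτ0 (by positivity) (by norm_num) (by linarith)
    _ = _ := by ring

lemma exists_invGauss_zone_le (m : ℕ) :
    ∃ C : ℝ, 0 < C ∧ ∀ b : Euc m, 0 < ‖b‖ →
      invGauss m (zone b) ≤ ENNReal.ofReal (C * (exp (‖b‖ ^ 2) / ‖b‖ ^ (m + 1))) := by
  obtain ⟨C, hC1, hC⟩ := exists_exp_neg_le_decay m
  obtain ⟨I, hI0, hI⟩ := exists_lintegral_decay_le m
  refine ⟨exp 2 * C * 4 ^ (m + 2) * I, by positivity, fun b hb => ?_⟩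
  rw [invGauss, withDensity_apply _ (measurableSet_zone b)]
  calc ∫⁻ a in zone b, ENNReal.ofReal (exp (‖a‖ ^ 2))
      ≤ ∫⁻ a in zone b, ENNReal.ofReal (exp 2 * C * 4 ^ (m + 2) * exp (‖b‖ ^ 2)) *
          ENNReal.ofReal (decay m (‖b‖ * ‖a - b‖)) := by
        refine setLIntegral_mono' (measurableSet_zone b) fun a ha => ?_
        rw [← ENNReal.ofReal_mul (by positivity)]
        exact ENNReal.ofReal_le_ofReal (exp_norm_sq_le_of_mem_zone hC hC1 ha)
    _ ≤ ∫⁻ a, ENNReal.ofReal (exp 2 * C * 4 ^ (m + 2) * exp (‖b‖ ^ 2)) *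
          ENNReal.ofReal (decay m (‖b‖ * ‖a - b‖)) := setLIntegral_le_lintegral _ _
    _ = ENNReal.ofReal (exp 2 * C * 4 ^ (m + 2) * exp (‖b‖ ^ 2)) *
          ∫⁻ a, ENNReal.ofReal (decay m (‖b‖ * ‖a - b‖)) :=
        lintegral_const_mul' _ _ ENNReal.ofReal_ne_top
    _ ≤ ENNReal.ofReal (exp 2 * C * 4 ^ (m + 2) * exp (‖b‖ ^ 2)) *
          ENNReal.ofReal (I / ‖b‖ ^ (m + 1)) := by
        gcongr
        exact hI _ _ hb
    _ = _ := by
        rw [← ENNReal.ofReal_mul (by positivity)]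
        congr 1
        ring

lemma not_sep_self {m : ℕ} (a : Euc m) : ¬ Sep a a := by simp [Sep]

lemma exists_sep_subset_zone_cover {m : ℕ} (E : Set (Euc m)) {k : ℝ} (hE : ∀ x ∈ E, ‖x‖ ≤ k) :
    ∃ u ⊆ E, u.Pairwise Sep ∧ E ⊆ ⋃ b ∈ u, zone b := by
  obtain ⟨u, huE, hdisj, hcov⟩ := Vitali.exists_disjoint_subfamily_covering_enlargement
    (fun a : Euc m => {p : Euc m × Euc m | ¬ Sep p.1 p.2 ∧ (p.1 = a ∨ p.2 = a)}) E
    (fun a => exp (‖a‖ ^ 2)) (exp 1) (Real.one_lt_exp_iff.2 one_pos)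
    (fun a _ => (Real.exp_pos _).le) (exp (k ^ 2))
    (fun a ha => Real.exp_le_exp.2 (pow_le_pow_left₀ (norm_nonneg _) (hE a ha) 2))
    (fun a _ => ⟨(a, a), not_sep_self a, Or.inl rfl⟩)
  refine ⟨u, huE, fun a ha b hb hab => ?_, fun a ha => ?_⟩
  · by_contra hsep
    refine Set.not_disjoint_iff.2 ?_ (hdisj ha hb hab)
    exact ⟨(a, b), ⟨hsep, Or.inl rfl⟩, ⟨hsep, Or.inr rfl⟩⟩
  · obtain ⟨b, hb, ⟨⟨p, q⟩, ⟨hp, hpa⟩, -, hpb⟩, hδ⟩ := hcov a ha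
    rw [← Real.exp_add, Real.exp_le_exp] at hδ
    refine Set.mem_biUnion hb ⟨by linarith, ?_⟩
    simp only at hp hpa hpb
    rcases hpa with rfl | rfl <;> rcases hpb with rfl | rfl
    · exact not_sep_self _
    · exact hp
    · exact fun h => hp h.symm
    · exact not_sep_self _

lemma countable_of_pairwise_sep {m : ℕ} {u : Set (Euc m)} {k : ℝ} (hk : 0 < k)
    (hu : ∀ x ∈ u, ‖x‖ ≤ k) (hsep : u.Pairwise Sep) : u.Countable := by
  have hd : u.PairwiseDisjoint fun x => Metric.ball x (1 / (2 * k)) := fun a ha b hb hab => by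
    refine Metric.ball_disjoint_ball ?_
    have h : Sep a b := hsep ha hb hab
    unfold Sep at h
    have h1 := abs_nonneg (‖a‖ ^ 2 - ‖b‖ ^ 2)
    have h2 : max ‖a‖ ‖b‖ * ‖a - b‖ ≤ k * ‖a - b‖ := by
      gcongr
      exact max_le (hu a ha) (hu b hb)
    have e : 1 / (2 * k) + 1 / (2 * k) = 1 / k := by field_simp; norm_num
    rw [e, dist_eq_norm, div_le_iff₀ hk]
    linarith
  refine hd.countable_of_isOpen (fun _ _ => Metric.isOpen_ball) fun x _ => ?_
  exact Metric.nonempty_ball.2 (by positivity)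

lemma measurable_coneTerm {m : ℕ} (r : ℝ) (x : Euc m) : Measurable (coneTerm r x) := by
  unfold coneTerm
  fun_prop

lemma coneTerm_nonneg {m : ℕ} {r : ℝ} (hr : 0 ≤ r) (x y : Euc m) : 0 ≤ coneTerm r x y := by
  unfold coneTerm
  positivity

theorem exists_invGauss_cone_weak_type (m : ℕ) :
    ∃ C : ℝ, 0 < C ∧ ∀ (ν : Measure (Euc m)) (l : ℝ≥0∞),
      l * invGauss m {x | ∃ r : ℝ, 0 < r ∧ r < 1 ∧ 1 ≤ (1 - r ^ 2) * ‖x‖ ^ 2 ∧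
        l < ∫⁻ y, ENNReal.ofReal (exp (-‖x‖ ^ 2) * ‖x‖ ^ (m + 1) * coneTerm r x y) ∂ν}
      ≤ ENNReal.ofReal C * ν Set.univ := by
  obtain ⟨C₁, hC₁, hzone⟩ := exists_invGauss_zone_le m
  obtain ⟨C₂, hC₂, hsum⟩ := exists_sum_coneTerm_le m
  refine ⟨C₁ * C₂, by positivity, fun ν l => ?_⟩
  set E := {x : Euc m | ∃ r : ℝ, 0 < r ∧ r < 1 ∧ 1 ≤ (1 - r ^ 2) * ‖x‖ ^ 2 ∧
        l < ∫⁻ y, ENNReal.ofReal (exp (-‖x‖ ^ 2) * ‖x‖ ^ (m + 1) * coneTerm r x y) ∂ν} with hE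
  have key : ∀ k : ℕ, l * invGauss m (E ∩ {x | ‖x‖ ≤ k}) ≤ ENNReal.ofReal (C₁ * C₂) * ν Set.univ := by
    intro k
    obtain ⟨u, huE, hsep, hcov⟩ :=
      exists_sep_subset_zone_cover (E ∩ {x | ‖x‖ ≤ k}) (k := k) (fun x hx => hx.2)
    have hcount : u.Countable :=
      countable_of_pairwise_sep (k := k + 1) (by positivity)
        (fun x hx => (huE hx).2.trans (by linarith)) hsep
    have hch : ∀ x, ∃ r : ℝ, x ∈ u → 0 < r ∧ r < 1 ∧ 1 ≤ (1 - r ^ 2) * ‖x‖ ^ 2 ∧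
        l < ∫⁻ y, ENNReal.ofReal (exp (-‖x‖ ^ 2) * ‖x‖ ^ (m + 1) * coneTerm r x y) ∂ν := by
      intro x
      by_cases hx : x ∈ u
      · obtain ⟨r, hr⟩ := (huE hx).1
        exact ⟨r, fun _ => hr⟩
      · exact ⟨0, fun h => absurd h hx⟩
    choose r hr using hch
    have hcu := hcount.to_subtype
    calc l * invGauss m (E ∩ {x | ‖x‖ ≤ k})
        ≤ l * ∑' b : u, invGauss m (zone (b : Euc m)) := by
          gcongr
          exact (measure_mono hcov).trans (measure_biUnion_le _ hcount _)
      _ = ∑' b : u, l * invGauss m (zone (b : Euc m)) := ENNReal.tsum_mul_left.symm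
      _ ≤ ∑' b : u, ∫⁻ y, ENNReal.ofReal (C₁ * coneTerm (r b) (b : Euc m) y) ∂ν := by
          refine ENNReal.tsum_le_tsum fun b => ?_
          obtain ⟨hr0, hr1, hrb, hl⟩ := hr b b.2
          have hb : 0 < ‖(b : Euc m)‖ := by
            by_contra! h
            have : ‖(b : Euc m)‖ = 0 := le_antisymm h (norm_nonneg _)
            rw [this] at hrb
            norm_num at hrb
          refine (mul_le_mul' hl.le (hzone b hb)).trans ?_
          rw [← lintegral_mul_const' _ _ ENNReal.ofReal_ne_top]
          refine lintegral_mono fun y => ?_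
          have := coneTerm_nonneg hr0.le (b : Euc m) y
          rw [← ENNReal.ofReal_mul (by positivity)]
          refine ENNReal.ofReal_le_ofReal (le_of_eq ?_)
          rw [Real.exp_neg]
          field_simp
      _ = ∫⁻ y, ∑' b : u, ENNReal.ofReal (C₁ * coneTerm (r b) (b : Euc m) y) ∂ν :=
          (lintegral_tsum fun b =>
            ((measurable_coneTerm _ _).const_mul _).ennreal_ofReal.aemeasurable).symm
      _ ≤ ∫⁻ _, ENNReal.ofReal (C₁ * C₂) ∂ν := by
          refine lintegral_mono fun y => ?_
          rw [ENNReal.tsum_eq_iSup_sum]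
          refine iSup_le fun T => ?_
          have hT : ∀ b ∈ T, 0 ≤ C₁ * coneTerm (r b) (b : Euc m) y := fun b _ =>
            mul_nonneg hC₁.le (coneTerm_nonneg (hr b b.2).1.le _ _)
          rw [← ENNReal.ofReal_sum_of_nonneg hT, ← Finset.mul_sum]
          refine ENNReal.ofReal_le_ofReal ?_
          gcongr
          have := hsum (T.map (Function.Embedding.subtype _)) r ?_ ?_ y
          · simpa using this
          · intro x hx
            obtain ⟨b, -, rfl⟩ := Finset.mem_map.1 hx
            obtain ⟨h1, h2, h3, -⟩ := hr b b.2
            exact ⟨h1, h2, h3⟩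
          · refine hsep.mono fun x hx => ?_
            obtain ⟨b, -, rfl⟩ := Finset.mem_map.1 (Finset.mem_coe.1 hx)
            exact b.2
      _ = ENNReal.ofReal (C₁ * C₂) * ν Set.univ := by rw [lintegral_const]
  have hU : E = ⋃ k : ℕ, E ∩ {x | ‖x‖ ≤ k} := by
    ext x
    simp only [Set.mem_iUnion, Set.mem_inter_iff, Set.mem_ofPred_eq, exists_and_left]
    exact ⟨fun h => ⟨h, exists_nat_ge _⟩, fun h => h.1⟩
  have hmono : Monotone fun k : ℕ => E ∩ {x : Euc m | ‖x‖ ≤ k} := fun i j hij x hx =>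
    ⟨hx.1, le_trans (show ‖x‖ ≤ i from hx.2) (by exact_mod_cast hij)⟩
  rw [hU, hmono.measure_iUnion, ENNReal.mul_iSup]
  exact iSup_le key

lemma exists_invGauss_closedBall_le (m : ℕ) :
    ∃ C : ℝ, 0 < C ∧ ∀ (x : Euc m) (R : ℝ), 0 < R → R * (1 + ‖x‖) ≤ 1 →
      invGauss m (Metric.closedBall x (5 * R)) ≤ ENNReal.ofReal (C * (exp (‖x‖ ^ 2) * R ^ (m + 1))) := by
  obtain ⟨v, hv0, hv⟩ := exists_volume_ball_eq m
  refine ⟨exp 35 * v * 5 ^ (m + 1), by positivity, fun x R hR hRx => ?_⟩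
  rw [invGauss, withDensity_apply _ Metric.isClosed_closedBall.measurableSet]
  calc ∫⁻ a in Metric.closedBall x (5 * R), ENNReal.ofReal (exp (‖a‖ ^ 2))
      ≤ ∫⁻ _ in Metric.closedBall x (5 * R), ENNReal.ofReal (exp (35 + ‖x‖ ^ 2)) := by
        refine setLIntegral_mono' Metric.isClosed_closedBall.measurableSet fun a ha => ?_
        refine ENNReal.ofReal_le_ofReal (Real.exp_le_exp.2 ?_)
        rw [Metric.mem_closedBall, dist_eq_norm] at ha
        have h1 : ‖a‖ ≤ ‖x‖ + 5 * R := by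
          have := norm_le_norm_add_norm_sub' a x
          linarith
        have hRx0 : 0 ≤ R * ‖x‖ := by positivity
        have h2 : ‖a‖ ^ 2 ≤ (‖x‖ + 5 * R) ^ 2 := pow_le_pow_left₀ (norm_nonneg _) h1 2
        have h3 : R ≤ 1 := by linarith
        have h4 : R * R ≤ 1 := by nlinarith
        nlinarith
    _ = ENNReal.ofReal (exp (35 + ‖x‖ ^ 2)) * ENNReal.ofReal (v * (5 * R) ^ (m + 1)) := by
        rw [lintegral_const, Measure.restrict_apply_univ,
          Measure.addHaar_closedBall_eq_addHaar_ball, hv _ _ (by positivity)]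
    _ = _ := by
        rw [← ENNReal.ofReal_mul (by positivity), Real.exp_add, mul_pow]
        congr 1
        ring

theorem exists_invGauss_maximal_weak_type (m : ℕ) :
    ∃ C : ℝ, 0 < C ∧ ∀ (ν : Measure (Euc m)) (l : ℝ≥0∞),
      l * invGauss m {x | ∃ R : ℝ, 0 < R ∧ R * (1 + ‖x‖) ≤ 1 ∧
        l * ENNReal.ofReal (exp (‖x‖ ^ 2) * R ^ (m + 1)) ≤ ν (Metric.closedBall x R)}
      ≤ ENNReal.ofReal C * ν Set.univ := by
  obtain ⟨C, hC0, hC⟩ := exists_invGauss_closedBall_le m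
  refine ⟨C, hC0, fun ν l => ?_⟩
  set E := {x : Euc m | ∃ R : ℝ, 0 < R ∧ R * (1 + ‖x‖) ≤ 1 ∧
        l * ENNReal.ofReal (exp (‖x‖ ^ 2) * R ^ (m + 1)) ≤ ν (Metric.closedBall x R)} with hE
  have hch : ∀ x, ∃ R : ℝ, x ∈ E → 0 < R ∧ R * (1 + ‖x‖) ≤ 1 ∧
        l * ENNReal.ofReal (exp (‖x‖ ^ 2) * R ^ (m + 1)) ≤ ν (Metric.closedBall x R) := by
    intro x
    by_cases hx : x ∈ E
    · obtain ⟨R, hR⟩ := hx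
      exact ⟨R, fun _ => hR⟩
    · exact ⟨0, fun h => absurd h hx⟩
  choose R hR using hch
  have hR1 : ∀ x ∈ E, R x ≤ 1 := fun x hx => by
    obtain ⟨h1, h2, -⟩ := hR x hx
    have : 0 ≤ R x * ‖x‖ := by positivity
    linarith
  obtain ⟨u, huE, hdisj, hcov⟩ := Vitali.exists_disjoint_subfamily_covering_enlargement_closedBall
    E (fun x => x) R 1 hR1 5 (by norm_num)
  have hcount : u.Countable := hdisj.countable_of_nonempty_interior fun x hx => by
    refine (Metric.nonempty_ball (x := x).2 (hR x (huE hx)).1).mono ?_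
    exact interior_maximal Metric.ball_subset_closedBall Metric.isOpen_ball
  have hsub : E ⊆ ⋃ b ∈ u, Metric.closedBall b (5 * R b) := fun x hx => by
    obtain ⟨b, hb, h⟩ := hcov x hx
    exact Set.mem_biUnion hb (h (Metric.mem_closedBall_self (hR x hx).1.le))
  calc l * invGauss m E ≤ l * ∑' b : u, invGauss m (Metric.closedBall (b : Euc m) (5 * R b)) := by
        gcongr
        exact (measure_mono hsub).trans (measure_biUnion_le _ hcount _)
    _ = ∑' b : u, l * invGauss m (Metric.closedBall (b : Euc m) (5 * R b)) :=
        ENNReal.tsum_mul_left.symm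
    _ ≤ ∑' b : u, ENNReal.ofReal C * ν (Metric.closedBall (b : Euc m) (R b)) := by
        refine ENNReal.tsum_le_tsum fun b => ?_
        obtain ⟨h1, h2, h3⟩ := hR b (huE b.2)
        refine (mul_le_mul_right (hC _ _ h1 h2) l).trans ?_
        rw [ENNReal.ofReal_mul hC0.le, mul_left_comm]
        gcongr
    _ = ENNReal.ofReal C * ν (⋃ b ∈ u, Metric.closedBall b (R b)) := by
        rw [ENNReal.tsum_mul_left, measure_biUnion hcount hdisj
          fun b _ => Metric.isClosed_closedBall.measurableSet]
    _ ≤ _ := by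
        gcongr
        exact Set.subset_univ _

/-- The size of the kernel at scale `σ` in the local regime. -/
noncomputable def localTerm {m : ℕ} (σ : ℝ) (x y : Euc m) : ℝ :=
  (σ ^ (m + 1))⁻¹ * exp (-(‖x - y‖ / σ))

lemma ofReal_exp_neg_le_tsum {u : ℝ} (hu : 0 ≤ u) :
    ENNReal.ofReal (exp (-u))
      ≤ ∑' k : ℕ, ENNReal.ofReal (exp (-k)) * (if u ≤ k + 1 then 1 else 0) := by
  refine le_trans ?_ (ENNReal.le_tsum ⌊u⌋₊)
  rw [if_pos (Nat.lt_floor_add_one u).le, mul_one]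
  exact ENNReal.ofReal_le_ofReal (Real.exp_le_exp.2 (neg_le_neg (Nat.floor_le hu)))

lemma exists_lintegral_localTerm_near_le (m : ℕ) :
    ∃ K : ℝ, 0 < K ∧ ∀ (ν : Measure (Euc m)) (A : ℝ≥0∞) (x : Euc m) (R σ : ℝ), 0 < R → 0 < σ →
      (∀ ρ, 0 < ρ → ρ ≤ R → ν (Metric.closedBall x ρ) ≤ A * ENNReal.ofReal (ρ ^ (m + 1))) →
      ∫⁻ y in Metric.closedBall x R, ENNReal.ofReal (localTerm σ x y) ∂ν
        ≤ ENNReal.ofReal K * A := by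
  have hs : Summable fun k : ℕ => ((k : ℝ) + 1) ^ (m + 1) * exp (-k) := by
    have h := (summable_nat_add_iff 1).2 (Real.summable_pow_mul_exp_neg_nat_mul (m + 1) one_pos)
    refine (h.mul_right (exp 1)).congr fun k => ?_
    rw [mul_assoc, ← Real.exp_add]
    push_cast
    congr 2
    ring
  have hnn : ∀ k : ℕ, 0 ≤ ((k : ℝ) + 1) ^ (m + 1) * exp (-k) := fun k => by positivity
  refine ⟨∑' k : ℕ, ((k : ℝ) + 1) ^ (m + 1) * exp (-k), hs.tsum_pos hnn 0 (by simp), ?_⟩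
  intro ν A x R σ hR hσ hν
  have hm : ∀ k : ℕ, MeasurableSet (Metric.closedBall x (min ((k + 1) * σ) R)) := fun k =>
    Metric.isClosed_closedBall.measurableSet
  calc ∫⁻ y in Metric.closedBall x R, ENNReal.ofReal (localTerm σ x y) ∂ν
      ≤ ∫⁻ y in Metric.closedBall x R, ∑' k : ℕ, (Metric.closedBall x (min ((k + 1) * σ) R)).indicator
          (fun _ => ENNReal.ofReal ((σ ^ (m + 1))⁻¹ * exp (-k))) y ∂ν := by
        refine setLIntegral_mono' Metric.isClosed_closedBall.measurableSet fun y hy => ?_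
        unfold localTerm
        rw [ENNReal.ofReal_mul (by positivity)]
        refine (mul_le_mul_right (ofReal_exp_neg_le_tsum (by positivity)) _).trans ?_
        rw [← ENNReal.tsum_mul_left]
        refine ENNReal.tsum_le_tsum fun k => ?_
        split_ifs with hk
        · rw [Set.indicator_of_mem, mul_one, ← ENNReal.ofReal_mul (by positivity)]
          rw [Metric.mem_closedBall] at hy ⊢
          refine le_min ?_ hy
          rwa [div_le_iff₀ hσ, ← dist_eq_norm, dist_comm] at hk
        · simp
    _ ≤ ∫⁻ y, ∑' k : ℕ, (Metric.closedBall x (min ((k + 1) * σ) R)).indicator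
          (fun _ => ENNReal.ofReal ((σ ^ (m + 1))⁻¹ * exp (-k))) y ∂ν :=
        setLIntegral_le_lintegral _ _
    _ = ∑' k : ℕ, ENNReal.ofReal ((σ ^ (m + 1))⁻¹ * exp (-k)) *
          ν (Metric.closedBall x (min ((k + 1) * σ) R)) := by
        rw [lintegral_tsum fun k => (measurable_const.indicator (hm k)).aemeasurable]
        exact tsum_congr fun k => lintegral_indicator_const (hm k) _
    _ ≤ ∑' k : ℕ, ENNReal.ofReal (((k : ℝ) + 1) ^ (m + 1) * exp (-k)) * A := by
        refine ENNReal.tsum_le_tsum fun k => ?_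
        have h0 : 0 < min (((k : ℝ) + 1) * σ) R := lt_min (by positivity) hR
        calc _ ≤ ENNReal.ofReal ((σ ^ (m + 1))⁻¹ * exp (-k)) *
              (A * ENNReal.ofReal (((k + 1) * σ) ^ (m + 1))) := by
              gcongr
              refine (hν _ h0 (min_le_right _ _)).trans ?_
              gcongr
              exact min_le_left _ _
          _ = ENNReal.ofReal ((σ ^ (m + 1))⁻¹ * exp (-k)) *
              ENNReal.ofReal (((k + 1) * σ) ^ (m + 1)) * A := by ring
          _ = _ := by
              rw [← ENNReal.ofReal_mul (by positivity), mul_pow]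
              congr 2
              field_simp
    _ = _ := by rw [ENNReal.tsum_mul_right, ENNReal.ofReal_tsum_of_nonneg hnn hs]

theorem exists_invGauss_near_weak_type (m : ℕ) :
    ∃ C : ℝ, 0 < C ∧ ∀ (ν : Measure (Euc m)) (l : ℝ≥0∞),
      l * invGauss m {x | ∃ σ : ℝ, 0 < σ ∧
        l < ∫⁻ y in Metric.closedBall x (1 + ‖x‖)⁻¹,
          ENNReal.ofReal (exp (-‖x‖ ^ 2) * localTerm σ x y) ∂ν}
      ≤ ENNReal.ofReal C * ν Set.univ := by
  obtain ⟨K, hK0, hK⟩ := exists_lintegral_localTerm_near_le m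
  obtain ⟨C, hC0, hC⟩ := exists_invGauss_maximal_weak_type m
  refine ⟨C * K, by positivity, fun ν l => ?_⟩
  have hmain := hC (ENNReal.ofReal K • ν) l
  rw [Measure.smul_apply, smul_eq_mul, ← mul_assoc, ← ENNReal.ofReal_mul hC0.le] at hmain
  refine le_trans (mul_le_mul_right (measure_mono ?_) l) hmain
  rintro x ⟨σ, hσ, hl⟩
  by_contra hx
  simp only [Set.mem_ofPred_eq, not_exists, not_and, not_le] at hx
  have hx0 : 0 < 1 + ‖x‖ := by positivity
  have key := hK (ENNReal.ofReal K • ν) (l * ENNReal.ofReal (exp (‖x‖ ^ 2))) x (1 + ‖x‖)⁻¹ σ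
    (by positivity) hσ fun ρ hρ hρR => by
      refine (hx ρ hρ ?_).le.trans (le_of_eq ?_)
      · rwa [← one_div, le_div_iff₀ hx0] at hρR
      · rw [ENNReal.ofReal_mul (by positivity), mul_assoc]
  rw [Measure.restrict_smul, lintegral_smul_measure, smul_eq_mul] at key
  have hKne : ENNReal.ofReal K ≠ 0 := by simpa using hK0
  have key2 := (ENNReal.mul_le_mul_iff_right hKne ENNReal.ofReal_ne_top).1 key
  refine absurd hl (not_lt.2 ?_)
  simp_rw [ENNReal.ofReal_mul (Real.exp_pos _).le]
  rw [lintegral_const_mul' _ _ ENNReal.ofReal_ne_top]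
  calc _ ≤ ENNReal.ofReal (exp (-‖x‖ ^ 2)) * (l * ENNReal.ofReal (exp (‖x‖ ^ 2))) := by gcongr
    _ = l * (ENNReal.ofReal (exp (-‖x‖ ^ 2)) * ENNReal.ofReal (exp (‖x‖ ^ 2))) := by ring
    _ = l := by
      rw [← ENNReal.ofReal_mul (by positivity), ← Real.exp_add, neg_add_cancel, Real.exp_zero,
        ENNReal.ofReal_one, mul_one]

/-- An approximate identity at the admissible scale `(1 + ‖x‖)⁻¹`. -/
noncomputable def farTerm {m : ℕ} (x y : Euc m) : ℝ :=
  (1 + ‖x‖) ^ (m + 1) * decay m ((1 + ‖x‖) * ‖x - y‖)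

lemma measurable_uncurry_farTerm (m : ℕ) :
    Measurable fun p : Euc m × Euc m => farTerm p.1 p.2 := by
  unfold farTerm
  refine Measurable.mul (by fun_prop) ((measurable_decay m).comp ?_)
  exact Continuous.measurable (by fun_prop)

lemma farTerm_le {m : ℕ} (x y : Euc m) :
    farTerm x y ≤ 2 ^ (m + 1) * 2 ^ (m + 2) * ((1 + ‖y‖) ^ (m + 1) * decay m ((1 + ‖y‖) * ‖x - y‖))
      + 2 ^ (m + 2) * decay m (1 * ‖x - 0‖) := by
  have hy := norm_nonneg y
  have hx := norm_nonneg x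
  have hd := norm_nonneg (x - y)
  have p1 := (decay_pos m (by positivity : 0 ≤ (1 + ‖y‖) * ‖x - y‖)).le
  have p2 := (decay_pos m (by positivity : 0 ≤ 1 * ‖x - 0‖)).le
  unfold farTerm
  by_cases h : ‖x - y‖ ≤ (1 + ‖x‖) / 2
  · have h1 : ‖x‖ ≤ ‖y‖ + ‖x - y‖ := norm_le_norm_add_norm_sub' x y
    have h2 : ‖y‖ ≤ ‖x‖ + ‖x - y‖ := norm_le_norm_add_norm_sub x y
    refine le_add_of_le_of_nonneg ?_ (by positivity)
    calc (1 + ‖x‖) ^ (m + 1) * decay m ((1 + ‖x‖) * ‖x - y‖)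
        ≤ (2 * (1 + ‖y‖)) ^ (m + 1) * (2 ^ (m + 2) * decay m ((1 + ‖y‖) * ‖x - y‖)) := by
          gcongr
          · exact (decay_pos m (by positivity)).le
          · linarith
          · refine decay_le_mul_decay m (by positivity) (by positivity) (by norm_num) ?_
            have : (1 + ‖y‖) * ‖x - y‖ ≤ (2 * (1 + ‖x‖)) * ‖x - y‖ := by
              gcongr
              linarith
            linarith
      _ = _ := by rw [mul_pow]; ring
  · push Not at h
    refine le_add_of_nonneg_of_le (by positivity) ?_
    rw [one_mul, sub_zero]
    unfold decay
    rw [← div_eq_mul_inv, ← div_eq_mul_inv, div_le_div_iff₀ (by positivity) (by positivity)]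
    calc (1 + ‖x‖) ^ (m + 1) * (1 + ‖x‖) ^ (m + 2)
        ≤ (1 + ‖x‖) ^ (m + 2) * (1 + ‖x‖) ^ (m + 2) := by
          gcongr ?_ * _
          exact pow_le_pow_right₀ (by linarith) (by lia)
      _ = ((1 + ‖x‖) * (1 + ‖x‖)) ^ (m + 2) := by rw [mul_pow]
      _ ≤ (2 * (1 + (1 + ‖x‖) * ‖x - y‖)) ^ (m + 2) := by
          refine pow_le_pow_left₀ (by positivity) ?_ _
          nlinarith
      _ = _ := by rw [mul_pow]

lemma exists_lintegral_farTerm_le (m : ℕ) :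
    ∃ C : ℝ, 0 < C ∧ ∀ y : Euc m, ∫⁻ x, ENNReal.ofReal (farTerm x y) ≤ ENNReal.ofReal C := by
  obtain ⟨I, hI0, hI⟩ := exists_lintegral_decay_le m
  refine ⟨2 ^ (m + 1) * 2 ^ (m + 2) * I + 2 ^ (m + 2) * I, by positivity, fun y => ?_⟩
  have hy : 0 < 1 + ‖y‖ := by positivity
  have hn : ∀ (a : ℝ) (c x : Euc m), 0 ≤ a → 0 ≤ decay m (a * ‖x - c‖) := fun a c x ha =>
    (decay_pos m (by positivity)).le
  calc ∫⁻ x, ENNReal.ofReal (farTerm x y)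
      ≤ ∫⁻ x : Euc m, (ENNReal.ofReal (2 ^ (m + 1) * 2 ^ (m + 2) * (1 + ‖y‖) ^ (m + 1)) *
            ENNReal.ofReal (decay m ((1 + ‖y‖) * ‖x - y‖)) +
          ENNReal.ofReal (2 ^ (m + 2)) * ENNReal.ofReal (decay m (1 * ‖x - 0‖))) := by
        refine lintegral_mono fun x => ?_
        have h1 := hn (1 + ‖y‖) y x hy.le
        have h2 := hn 1 0 x zero_le_one
        rw [← ENNReal.ofReal_mul (by positivity), ← ENNReal.ofReal_mul (by positivity),
          ← ENNReal.ofReal_add (by positivity) (by positivity)]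
        exact ENNReal.ofReal_le_ofReal ((farTerm_le x y).trans_eq (by ring))
    _ = ENNReal.ofReal (2 ^ (m + 1) * 2 ^ (m + 2) * (1 + ‖y‖) ^ (m + 1)) *
            (∫⁻ x : Euc m, ENNReal.ofReal (decay m ((1 + ‖y‖) * ‖x - y‖))) +
          ENNReal.ofReal (2 ^ (m + 2)) *
            (∫⁻ x : Euc m, ENNReal.ofReal (decay m (1 * ‖x - 0‖))) := by
        rw [lintegral_add_right, lintegral_const_mul' _ _ ENNReal.ofReal_ne_top,
          lintegral_const_mul' _ _ ENNReal.ofReal_ne_top]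
        exact ((measurable_decay m).comp
          (f := fun x : Euc m => 1 * ‖x - 0‖) (by fun_prop)).ennreal_ofReal.const_mul _
    _ ≤ ENNReal.ofReal (2 ^ (m + 1) * 2 ^ (m + 2) * (1 + ‖y‖) ^ (m + 1)) *
            ENNReal.ofReal (I / (1 + ‖y‖) ^ (m + 1)) +
          ENNReal.ofReal (2 ^ (m + 2)) * ENNReal.ofReal (I / 1 ^ (m + 1)) := by
        gcongr
        · exact hI _ _ hy
        · exact hI _ _ one_pos
    _ = _ := by
        rw [← ENNReal.ofReal_mul (by positivity), ← ENNReal.ofReal_mul (by positivity),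
          ← ENNReal.ofReal_add (by positivity) (by positivity)]
        congr 1
        field_simp
        simp

lemma farTerm_nonneg {m : ℕ} (x y : Euc m) : 0 ≤ farTerm x y :=
  mul_nonneg (by positivity) (decay_pos m (by positivity)).le

theorem exists_invGauss_far_weak_type (m : ℕ) :
    ∃ C : ℝ, 0 < C ∧ ∀ (ν : Measure (Euc m)) [IsFiniteMeasure ν] (l : ℝ≥0∞),
      l * invGauss m {x | l < ∫⁻ y, ENNReal.ofReal (exp (-‖x‖ ^ 2) * farTerm x y) ∂ν}
      ≤ ENNReal.ofReal C * ν Set.univ := by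
  obtain ⟨C, hC0, hC⟩ := exists_lintegral_farTerm_le m
  refine ⟨C, hC0, fun ν _ l => ?_⟩
  have hmeas : Measurable fun p : Euc m × Euc m =>
      ENNReal.ofReal (exp (-‖p.1‖ ^ 2) * farTerm p.1 p.2) :=
    (Measurable.mul (by fun_prop) (measurable_uncurry_farTerm m)).ennreal_ofReal
  have hF : Measurable fun x : Euc m => ∫⁻ y, ENNReal.ofReal (exp (-‖x‖ ^ 2) * farTerm x y) ∂ν :=
    hmeas.lintegral_prod_right'
  calc _ ≤ l * invGauss m {x | l ≤ ∫⁻ y, ENNReal.ofReal (exp (-‖x‖ ^ 2) * farTerm x y) ∂ν} := by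
        refine mul_le_mul_right (measure_mono fun x hx => ?_) l
        simp only [Set.mem_ofPred_eq] at hx ⊢
        exact hx.le
    _ ≤ ∫⁻ x, ∫⁻ y, ENNReal.ofReal (exp (-‖x‖ ^ 2) * farTerm x y) ∂ν ∂invGauss m :=
        mul_meas_ge_le_lintegral hF l
    _ = ∫⁻ x, ∫⁻ y, ENNReal.ofReal (farTerm x y) ∂ν := by
        rw [invGauss, lintegral_withDensity_eq_lintegral_mul _ (by fun_prop) hF]
        refine lintegral_congr fun x => ?_
        rw [Pi.mul_apply, ← lintegral_const_mul' _ _ ENNReal.ofReal_ne_top]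
        refine lintegral_congr fun y => ?_
        rw [← ENNReal.ofReal_mul (by positivity), ← mul_assoc, ← Real.exp_add, add_neg_cancel,
          Real.exp_zero, one_mul]
    _ = ∫⁻ y, (∫⁻ x, ENNReal.ofReal (farTerm x y)) ∂ν :=
        lintegral_lintegral_swap (measurable_uncurry_farTerm m).ennreal_ofReal.aemeasurable
    _ ≤ ∫⁻ _, ENNReal.ofReal C ∂ν := lintegral_mono fun y => hC y
    _ = _ := by rw [lintegral_const]

lemma exists_localTerm_le_farTerm (m : ℕ) :
    ∃ C : ℝ, 0 < C ∧ ∀ (σ : ℝ) (x y : Euc m), 0 < σ → σ * (1 + ‖x‖) ≤ 2 →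
      (1 + ‖x‖)⁻¹ < ‖x - y‖ → localTerm σ x y ≤ C * farTerm x y := by
  obtain ⟨C, hC1, hC⟩ := exists_exp_neg_le_decay m
  refine ⟨2 ^ (m + 1) * (m + 1).factorial * (C * 4 ^ (m + 2)), by positivity,
    fun σ x y hσ hσx hd => ?_⟩
  have hx : 0 < 1 + ‖x‖ := by positivity
  have hd0 : 0 < ‖x - y‖ := lt_trans (by positivity) hd
  set d := ‖x - y‖
  set w := d / σ with hw
  have hw0 : 0 < w := by positivity
  have h1 : w ^ (m + 1) ≤ 2 ^ (m + 1) * (m + 1).factorial * exp (w / 2) := by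
    have := Real.pow_div_factorial_le_exp (x := w / 2) (by positivity) (m + 1)
    rw [div_le_iff₀ (by positivity), div_pow, div_le_iff₀ (by positivity)] at this
    linarith
  have h2 : (σ ^ (m + 1))⁻¹ ≤ (1 + ‖x‖) ^ (m + 1) * w ^ (m + 1) := by
    rw [← inv_pow, ← mul_pow]
    gcongr
    rw [hw, ← one_div, mul_div_assoc']
    gcongr
    rw [inv_lt_iff_one_lt_mul₀ hx] at hd
    rw [mul_comm]
    exact hd.le
  have h3 : (1 + ‖x‖) * d / 4 ≤ w / 2 := by
    rw [hw, div_div, div_le_div_iff₀ (by norm_num) (by positivity)]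
    have : σ * (1 + ‖x‖) * d ≤ 2 * d := by gcongr
    linarith
  unfold localTerm farTerm
  calc (σ ^ (m + 1))⁻¹ * exp (-w)
      ≤ (1 + ‖x‖) ^ (m + 1) * (2 ^ (m + 1) * (m + 1).factorial * exp (w / 2)) * exp (-w) := by
        gcongr
        exact h2.trans (by gcongr)
    _ = (1 + ‖x‖) ^ (m + 1) * (2 ^ (m + 1) * (m + 1).factorial) * exp (-(w / 2)) := by
        rw [show -(w / 2) = w / 2 + -w by ring, Real.exp_add]; ring
    _ ≤ (1 + ‖x‖) ^ (m + 1) * (2 ^ (m + 1) * (m + 1).factorial) *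
          (C * (4 ^ (m + 2) * decay m ((1 + ‖x‖) * d))) := by
        gcongr
        calc exp (-(w / 2)) ≤ exp (-((1 + ‖x‖) * d / 4)) :=
              Real.exp_le_exp.2 (neg_le_neg h3)
          _ ≤ C * decay m ((1 + ‖x‖) * d / 4) := hC _ (by positivity)
          _ ≤ _ := by
            gcongr
            refine decay_le_mul_decay m (by positivity) (by positivity) (by norm_num) ?_
            linarith
    _ = _ := by ring

/-- The majorant of `t ∂ₜ` of the heat kernel, with `r = e^{-t}`, up to a Gaussian factor. -/
noncomputable def majorant {m : ℕ} (r : ℝ) (x y : Euc m) : ℝ :=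
  r ^ m * (√(1 - r ^ 2) ^ (m + 1))⁻¹ * (1 + ‖x‖ * √(1 - r ^ 2)) *
    exp (-(‖y - r • x‖ ^ 2 / (2 * (1 - r ^ 2))))

lemma majorant_le_coneTerm {m : ℕ} {r : ℝ} {x : Euc m} (y : Euc m) (hr : 0 < r) (hr1 : r < 1)
    (h : 1 ≤ (1 - r ^ 2) * ‖x‖ ^ 2) :
    majorant r x y ≤ 2 * (‖x‖ ^ (m + 1) * coneTerm r x y) := by
  have hs := one_sub_sq_pos hr hr1
  have h1 := one_le_norm_mul_sqrt (norm_nonneg x) h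
  have hσ : 0 < √(1 - r ^ 2) := Real.sqrt_pos.2 hs
  have hx : 0 < ‖x‖ := by
    by_contra! h0
    nlinarith
  unfold majorant coneTerm
  calc _ ≤ r ^ m * (√(1 - r ^ 2) ^ (m + 1))⁻¹ * (2 * (‖x‖ * √(1 - r ^ 2))) *
          exp (-(‖y - r • x‖ ^ 2 / (2 * (1 - r ^ 2)))) := by
        gcongr
        linarith
    _ = _ := by
        rw [div_pow, mul_pow, pow_succ, pow_succ]
        field_simp
        ring

lemma majorant_le_localTerm {m : ℕ} {r : ℝ} {x : Euc m} (y : Euc m) (hr : 0 < r) (hr1 : r < 1)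
    (h : (1 - r ^ 2) * ‖x‖ ^ 2 ≤ 1) :
    √(1 - r ^ 2) * (1 + ‖x‖) ≤ 2 ∧
      majorant r x y ≤ 2 * exp (3 / 2) * localTerm √(1 - r ^ 2) x y := by
  have hs := one_sub_sq_pos hr hr1
  set s := 1 - r ^ 2 with hsd
  have hσ : 0 < √s := Real.sqrt_pos.2 hs
  have hσ1 : √s ≤ 1 := Real.sqrt_le_one.2 (by rw [hsd]; linarith [sq_nonneg r])
  have hss : √s * √s = s := Real.mul_self_sqrt hs.le
  have h1 : ‖x‖ * √s ≤ 1 := by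
    have : √(s * ‖x‖ ^ 2) ≤ 1 := Real.sqrt_le_one.2 h
    rwa [Real.sqrt_mul hs.le, Real.sqrt_sq (norm_nonneg x), mul_comm] at this
  refine ⟨by linarith, ?_⟩
  have h2 : ‖x - y‖ ≤ ‖y - r • x‖ + √s := by
    have e : x - y = (1 - r) • x - (y - r • x) := by rw [sub_smul, one_smul]; abel
    have e2 : ‖(1 - r) • x‖ ≤ √s := by
      rw [norm_smul, Real.norm_of_nonneg (by linarith)]
      calc (1 - r) * ‖x‖ ≤ s * ‖x‖ := by
            gcongr
            rw [hsd]; nlinarith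
        _ = √s * (‖x‖ * √s) := by
          rw [show √s * (‖x‖ * √s) = √s * √s * ‖x‖ by ring, hss]
        _ ≤ √s * 1 := by gcongr
        _ = √s := mul_one _
    rw [e]
    linarith [norm_sub_le ((1 - r) • x) (y - r • x)]
  have h3 : ‖x - y‖ / √s ≤ ‖y - r • x‖ / √s + 1 := by
    rw [div_add_one hσ.ne']
    gcongr
  have h4 : ‖y - r • x‖ ^ 2 / (2 * s) = (‖y - r • x‖ / √s) ^ 2 / 2 := by
    rw [div_pow, Real.sq_sqrt hs.le]
    field_simp
  unfold majorant localTerm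
  rw [h4]
  calc _ ≤ 1 * (√s ^ (m + 1))⁻¹ * 2 * (exp (1 / 2) * exp (-(‖y - r • x‖ / √s))) := by
        gcongr
        · exact pow_le_one₀ hr.le hr1.le
        · linarith
        · exact exp_neg_sq_div_two_le _
    _ ≤ 1 * (√s ^ (m + 1))⁻¹ * 2 * (exp (1 / 2) * (exp 1 * exp (-(‖x - y‖ / √s)))) := by
        gcongr
        rw [← Real.exp_add]
        exact Real.exp_le_exp.2 (by linarith)
    _ = _ := by
        rw [show (3 / 2 : ℝ) = 1 / 2 + 1 by norm_num, Real.exp_add]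
        ring

theorem exists_invGauss_majorant_weak_type (m : ℕ) :
    ∃ C : ℝ, 0 < C ∧ ∀ (ν : Measure (Euc m)) [IsFiniteMeasure ν] (l : ℝ≥0∞),
      l * invGauss m {x | ∃ r : ℝ, 0 < r ∧ r < 1 ∧
        l < ∫⁻ y, ENNReal.ofReal (exp (-‖x‖ ^ 2) * majorant r x y) ∂ν}
      ≤ ENNReal.ofReal C * ν Set.univ := by
  obtain ⟨C₁, hC₁, hglob⟩ := exists_invGauss_cone_weak_type m
  obtain ⟨C₂, hC₂, hnear⟩ := exists_invGauss_near_weak_type m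
  obtain ⟨C₃, hC₃, hfar⟩ := exists_invGauss_far_weak_type m
  obtain ⟨C₄, hC₄, hloc⟩ := exists_localTerm_le_farTerm m
  set K := 2 * exp (3 / 2) * (1 + C₄) with hK
  have hK0 : 0 < K := by positivity
  have he : 1 ≤ exp (3 / 2) := Real.one_le_exp (by norm_num)
  refine ⟨2 * ((C₁ + C₂ + C₃) * K), by positivity, fun ν _ l => ?_⟩
  set ν' := ENNReal.ofReal K • ν with hν'
  have : IsFiniteMeasure ν' := Measure.smul_finite ν ENNReal.ofReal_ne_top
  have hint : ∀ g : Euc m → ℝ≥0∞, ∫⁻ y, g y ∂ν' = ∫⁻ y, ENNReal.ofReal K * g y ∂ν := fun g => by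
    rw [hν', lintegral_smul_measure, smul_eq_mul, lintegral_const_mul' _ _ ENNReal.ofReal_ne_top]
  set Eg := {x : Euc m | ∃ r : ℝ, 0 < r ∧ r < 1 ∧ 1 ≤ (1 - r ^ 2) * ‖x‖ ^ 2 ∧
    l / 2 < ∫⁻ y, ENNReal.ofReal (exp (-‖x‖ ^ 2) * ‖x‖ ^ (m + 1) * coneTerm r x y) ∂ν'} with hEg
  set En := {x : Euc m | ∃ σ : ℝ, 0 < σ ∧ l / 2 < ∫⁻ y in Metric.closedBall x (1 + ‖x‖)⁻¹,
    ENNReal.ofReal (exp (-‖x‖ ^ 2) * localTerm σ x y) ∂ν'} with hEn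
  set Ef := {x : Euc m | l / 2 < ∫⁻ y, ENNReal.ofReal (exp (-‖x‖ ^ 2) * farTerm x y) ∂ν'} with hEf
  have hsub : {x : Euc m | ∃ r : ℝ, 0 < r ∧ r < 1 ∧
      l < ∫⁻ y, ENNReal.ofReal (exp (-‖x‖ ^ 2) * majorant r x y) ∂ν} ⊆ Eg ∪ En ∪ Ef := by
    rintro x ⟨r, hr, hr1, hl⟩
    have hs := one_sub_sq_pos hr hr1
    rcases le_total 1 ((1 - r ^ 2) * ‖x‖ ^ 2) with h | h
    · refine Or.inl (Or.inl ⟨r, hr, hr1, h, ?_⟩)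
      refine ENNReal.half_le_self.trans_lt (hl.trans_le ?_)
      rw [hint]
      refine lintegral_mono fun y => ?_
      rw [← ENNReal.ofReal_mul hK0.le]
      refine ENNReal.ofReal_le_ofReal ?_
      have hc := coneTerm_nonneg hr.le x y
      calc exp (-‖x‖ ^ 2) * majorant r x y
          ≤ exp (-‖x‖ ^ 2) * (2 * (‖x‖ ^ (m + 1) * coneTerm r x y)) := by
            gcongr
            exact majorant_le_coneTerm y hr hr1 h
        _ = 2 * (exp (-‖x‖ ^ 2) * ‖x‖ ^ (m + 1) * coneTerm r x y) := by ring
        _ ≤ K * (exp (-‖x‖ ^ 2) * ‖x‖ ^ (m + 1) * coneTerm r x y) := by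
            gcongr
            nlinarith
    · set σ := √(1 - r ^ 2) with hσd
      have hσ : 0 < σ := Real.sqrt_pos.2 hs
      by_contra hx
      simp only [Set.mem_union, not_or] at hx
      obtain ⟨⟨-, hxn⟩, hxf⟩ := hx
      simp only [hEn, hEf, Set.mem_ofPred_eq, not_exists, not_and, not_lt] at hxn hxf
      have hxn := hxn σ hσ
      refine absurd hl (not_lt.2 ?_)
      have hmeas : MeasurableSet (Metric.closedBall x (1 + ‖x‖)⁻¹) :=
        Metric.isClosed_closedBall.measurableSet
      rw [← lintegral_add_compl _ hmeas, ← ENNReal.add_halves l]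
      have hloc0 : ∀ y, 0 ≤ localTerm σ x y := fun y => by unfold localTerm; positivity
      refine add_le_add (le_trans ?_ hxn) (le_trans ?_ hxf)
      · rw [hν', Measure.restrict_smul, lintegral_smul_measure, smul_eq_mul,
          ← lintegral_const_mul' _ _ ENNReal.ofReal_ne_top]
        refine lintegral_mono fun y => ?_
        rw [← ENNReal.ofReal_mul hK0.le]
        refine ENNReal.ofReal_le_ofReal ?_
        have := hloc0 y
        calc exp (-‖x‖ ^ 2) * majorant r x y
            ≤ exp (-‖x‖ ^ 2) * (2 * exp (3 / 2) * localTerm σ x y) := by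
              gcongr
              exact (majorant_le_localTerm y hr hr1 h).2
          _ = 2 * exp (3 / 2) * 1 * (exp (-‖x‖ ^ 2) * localTerm σ x y) := by ring
          _ ≤ K * (exp (-‖x‖ ^ 2) * localTerm σ x y) := by
              rw [hK]
              gcongr
              linarith
      · rw [hint]
        refine le_trans (setLIntegral_mono' hmeas.compl fun y hy => ?_)
          (setLIntegral_le_lintegral _ _)
        rw [← ENNReal.ofReal_mul hK0.le]
        refine ENNReal.ofReal_le_ofReal ?_
        have := farTerm_nonneg x y
        rw [Set.mem_compl_iff, Metric.mem_closedBall, dist_comm, dist_eq_norm, not_le] at hy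
        obtain ⟨ha, hb⟩ := majorant_le_localTerm y hr hr1 h
        calc exp (-‖x‖ ^ 2) * majorant r x y
            ≤ exp (-‖x‖ ^ 2) * (2 * exp (3 / 2) * (C₄ * farTerm x y)) := by
              gcongr
              refine hb.trans ?_
              gcongr
              exact hloc σ x y hσ ha hy
          _ = 2 * exp (3 / 2) * C₄ * (exp (-‖x‖ ^ 2) * farTerm x y) := by ring
          _ ≤ K * (exp (-‖x‖ ^ 2) * farTerm x y) := by
              rw [hK]
              gcongr
              linarith
  calc _ ≤ l * invGauss m (Eg ∪ En ∪ Ef) := mul_le_mul_right (measure_mono hsub) l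
    _ ≤ l * (invGauss m Eg + invGauss m En + invGauss m Ef) := by
        gcongr
        exact (measure_union_le _ _).trans (add_le_add_left (measure_union_le _ _) _)
    _ = 2 * (l / 2 * invGauss m Eg + l / 2 * invGauss m En + l / 2 * invGauss m Ef) := by
        rw [← mul_add, ← mul_add, ← mul_assoc, ENNReal.mul_div_cancel two_ne_zero
          ENNReal.ofNat_ne_top]
    _ ≤ 2 * (ENNReal.ofReal C₁ * ν' Set.univ + ENNReal.ofReal C₂ * ν' Set.univ +
          ENNReal.ofReal C₃ * ν' Set.univ) := by
        exact mul_le_mul_right (add_le_add (add_le_add (hglob ν' (l / 2)) (hnear ν' (l / 2)))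
          (hfar ν' (l / 2))) 2
    _ = _ := by
        rw [hν', Measure.smul_apply, smul_eq_mul, ← add_mul, ← add_mul,
          ← ENNReal.ofReal_add hC₁.le hC₂.le, ← ENNReal.ofReal_add (by positivity) hC₃.le,
          ENNReal.ofReal_mul zero_le_two,
          ENNReal.ofReal_mul (p := C₁ + C₂ + C₃) (q := K) (by positivity), ENNReal.ofReal_ofNat]
        ring

lemma norm_sub_smul_sq_eq {m : ℕ} (r : ℝ) (x y : Euc m) :
    ‖x - r • y‖ ^ 2 = (1 - r ^ 2) * (‖x‖ ^ 2 - ‖y‖ ^ 2) + ‖y - r • x‖ ^ 2 := by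
  rw [norm_sub_sq_real, norm_sub_sq_real, norm_smul, norm_smul, inner_smul_right, inner_smul_right,
    mul_pow, mul_pow, real_inner_comm x y, Real.norm_eq_abs, sq_abs]
  ring

lemma one_sub_exp_pos {t : ℝ} (ht : 0 < t) : 0 < 1 - exp (-t) ^ 2 :=
  one_sub_sq_pos (exp_pos _) (by rw [Real.exp_lt_one_iff]; linarith)

lemma exp_neg_two_mul_eq (t : ℝ) : exp (-2 * t) = exp (-t) ^ 2 := by
  rw [← Real.exp_nat_mul]
  congr 1
  push_cast
  ring

lemma heatKerA_eq {m : ℕ} {t : ℝ} (ht : 0 < t) (x y : Euc m) :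
    heatKerA (m + 1) t x y = π ^ (-((m + 1 : ℕ) : ℝ) / 2) * exp (‖y‖ ^ 2) * exp (-‖x‖ ^ 2) *
      (exp (-t) ^ (m + 1) * (√(1 - exp (-t) ^ 2) ^ (m + 1))⁻¹ *
        exp (-(‖y - exp (-t) • x‖ ^ 2 / (1 - exp (-t) ^ 2)))) := by
  have hs := one_sub_exp_pos ht
  unfold heatKerA
  rw [exp_neg_two_mul_eq, norm_sub_smul_sq_eq]
  set r := exp (-t) with hr
  have e1 : exp (-((m + 1 : ℕ) : ℝ) * t) = r ^ (m + 1) := by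
    rw [hr, ← Real.exp_nat_mul]
    congr 1
    push_cast
    ring
  have e2 : (1 - r ^ 2) ^ (-((m + 1 : ℕ) : ℝ) / 2) = (√(1 - r ^ 2) ^ (m + 1))⁻¹ := by
    rw [Real.sqrt_eq_rpow, ← Real.rpow_natCast _ (m + 1), ← Real.rpow_mul hs.le, ← Real.rpow_neg hs.le]
    congr 1
    ring
  have e3 : -((1 - r ^ 2) * (‖x‖ ^ 2 - ‖y‖ ^ 2) + ‖y - r • x‖ ^ 2) / (1 - r ^ 2) =
      ‖y‖ ^ 2 + -‖x‖ ^ 2 + -(‖y - r • x‖ ^ 2 / (1 - r ^ 2)) := by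
    field_simp
    ring
  rw [e1, e2, e3, Real.exp_add, Real.exp_add]
  ring

/-- The logarithmic time derivative of the heat kernel. -/
noncomputable def heatRate {m : ℕ} (t : ℝ) (x y : Euc m) : ℝ :=
  -((m : ℝ) + 1) / (1 - exp (-t) ^ 2)
    - 2 * exp (-t) * inner ℝ x (y - exp (-t) • x) / (1 - exp (-t) ^ 2)
    + 2 * exp (-t) ^ 2 * ‖y - exp (-t) • x‖ ^ 2 / (1 - exp (-t) ^ 2) ^ 2

lemma hasDerivAt_heatKerA {m : ℕ} {t : ℝ} (ht : 0 < t) (x y : Euc m) :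
    HasDerivAt (fun s => heatKerA (m + 1) s x y) (heatKerA (m + 1) t x y * heatRate t x y) t := by
  have hs := one_sub_exp_pos ht
  have hr : HasDerivAt (fun s : ℝ => exp (-s)) (-exp (-t)) t := by
    simpa using (hasDerivAt_neg t).exp
  have hS : HasDerivAt (fun s : ℝ => 1 - exp (-2 * s)) (2 * exp (-t) ^ 2) t := by
    have := (((hasDerivAt_id t).const_mul (-2)).exp).const_sub 1
    simp only [id] at this
    rw [exp_neg_two_mul_eq] at this
    refine this.congr_deriv ?_
    ring
  have hN : HasDerivAt (fun s : ℝ => ‖x - exp (-s) • y‖ ^ 2)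
      (2 * inner ℝ (x - exp (-t) • y) (-(-exp (-t) • y))) t :=
    ((hr.smul_const y).const_sub x).norm_sq
  have hE : HasDerivAt (fun s : ℝ => exp (-((m + 1 : ℕ) : ℝ) * s))
      (exp (-((m + 1 : ℕ) : ℝ) * t) * -((m + 1 : ℕ) : ℝ)) t := by
    simpa using ((hasDerivAt_id t).const_mul (-((m + 1 : ℕ) : ℝ))).exp
  have hS0 : 1 - exp (-2 * t) ≠ 0 := by rw [exp_neg_two_mul_eq]; exact hs.ne'
  have hP := hS.rpow_const (p := -((m + 1 : ℕ) : ℝ) / 2) (Or.inl hS0)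
  have hG := (hN.neg.div hS hS0).exp
  have := ((hE.mul_const (π ^ (-((m + 1 : ℕ) : ℝ) / 2))).mul hP).mul hG
  refine this.congr_deriv ?_
  unfold heatKerA heatRate
  rw [Real.rpow_sub_one hS0]
  simp only [Pi.neg_apply, Pi.mul_apply, Pi.div_apply]
  rw [norm_sub_sq_real, norm_sub_sq_real y, inner_sub_right, inner_sub_left, exp_neg_two_mul_eq]
  simp only [inner_smul_right, inner_smul_left, neg_smul, neg_neg, norm_smul,
    mul_pow, real_inner_self_eq_norm_sq, real_inner_comm x y, Real.norm_eq_abs, sq_abs,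
    conj_trivial]
  set r := exp (-t)
  set A := exp (-((m + 1 : ℕ) : ℝ) * t)
  set B := π ^ (-((m + 1 : ℕ) : ℝ) / 2)
  set S := 1 - r ^ 2 with hSd
  set Q := S ^ (-((m + 1 : ℕ) : ℝ) / 2)
  set E := exp (-(‖x‖ ^ 2 - 2 * (r * inner ℝ x y) + r ^ 2 * ‖y‖ ^ 2) / S)
  clear_value A B Q E S
  clear hr hS hN hP hG hE hS0 this
  push_cast
  field_simp
  rw [hSd]
  ring

lemma two_mul_mul_exp_neg_le {t : ℝ} (ht : 0 < t) : 2 * t * exp (-t) ≤ 1 - exp (-t) ^ 2 := by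
  have h := Real.self_le_sinh_iff.2 ht.le
  rw [Real.sinh_eq] at h
  have h2 : exp t * exp (-t) = 1 := by rw [← Real.exp_add]; simp
  nlinarith [exp_pos (-t)]

lemma abs_mul_deriv_heatKerA_le {m : ℕ} {t : ℝ} (ht : 0 < t) (x y : Euc m) :
    t * |heatKerA (m + 1) t x y * heatRate t x y| ≤
      (m + 5) * exp (‖y‖ ^ 2) * (exp (-‖x‖ ^ 2) * majorant (exp (-t)) x y) := by
  have hs := one_sub_exp_pos ht
  have h2 := two_mul_mul_exp_neg_le ht
  rw [heatKerA_eq ht]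
  unfold heatRate majorant
  have hr0 := exp_pos (-t)
  have hr1 : exp (-t) < 1 := by rw [Real.exp_lt_one_iff]; linarith
  set r := exp (-t) with hr
  set z := y - r • x
  set S := 1 - r ^ 2 with hS
  set B := π ^ (-((m + 1 : ℕ) : ℝ) / 2) with hB
  have hB0 : 0 < B := by positivity
  have hB1 : B ≤ 1 := by
    refine Real.rpow_le_one_of_one_le_of_nonpos (by linarith [Real.pi_gt_three]) ?_
    rw [neg_div]
    exact neg_nonpos.2 (by positivity)
  have hσ : 0 < √S := Real.sqrt_pos.2 hs
  have hσ2 : √S ^ 2 = S := Real.sq_sqrt hs.le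
  set w := ‖z‖ / √S with hw
  have hw0 : 0 ≤ w := by positivity
  have hz : ‖z‖ = √S * w := by rw [hw]; field_simp
  have hw2 : ‖z‖ ^ 2 / S = w ^ 2 := by rw [hw, div_pow, hσ2]
  have hw3 : ‖z‖ ^ 2 / (2 * S) = w ^ 2 / 2 := by rw [← hw2]; field_simp
  have hD : t * r * |-((m : ℝ) + 1) / S - 2 * r * inner ℝ x z / S + 2 * r ^ 2 * ‖z‖ ^ 2 / S ^ 2| ≤
      (m + 1) + 2 * (‖x‖ * √S) * w + 2 * w ^ 2 := by
    have htr : t * r / S ≤ 1 := by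
      rw [div_le_one hs]
      have : 0 < t * r := by positivity
      linarith
    have hin := abs_real_inner_le_norm x z
    have hb : |-((m : ℝ) + 1) / S - 2 * r * inner ℝ x z / S + 2 * r ^ 2 * ‖z‖ ^ 2 / S ^ 2| ≤
        ((m + 1) + 2 * (‖x‖ * ‖z‖) + 2 * w ^ 2) / S := by
      have e : -((m : ℝ) + 1) / S - 2 * r * inner ℝ x z / S + 2 * r ^ 2 * ‖z‖ ^ 2 / S ^ 2 =
          (-((m : ℝ) + 1) - 2 * (r * inner ℝ x z) + 2 * (r ^ 2 * w ^ 2)) / S := by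
        rw [← hw2]; field_simp
      rw [e, abs_div, abs_of_pos hs]
      gcongr
      have h3 : |r * inner ℝ x z| ≤ ‖x‖ * ‖z‖ := by
        rw [abs_mul, abs_of_pos hr0]
        exact (mul_le_of_le_one_left (abs_nonneg _) hr1.le).trans hin
      have h4 : r ^ 2 * w ^ 2 ≤ w ^ 2 := mul_le_of_le_one_left (sq_nonneg w) (by linarith)
      have h5 : 0 ≤ r ^ 2 * w ^ 2 := by positivity
      have h6 := abs_le.1 h3
      rw [abs_le]
      constructor <;> linarith [h6.1, h6.2, Nat.cast_nonneg (α := ℝ) m, sq_nonneg w]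
    calc _ ≤ t * r * (((m + 1) + 2 * (‖x‖ * ‖z‖) + 2 * w ^ 2) / S) := by gcongr
      _ = t * r / S * ((m + 1) + 2 * (‖x‖ * ‖z‖) + 2 * w ^ 2) := by ring
      _ ≤ 1 * ((m + 1) + 2 * (‖x‖ * ‖z‖) + 2 * w ^ 2) := by gcongr
      _ = _ := by rw [hz]; ring
  have hexp : ((m + 1) + 2 * (‖x‖ * √S) * w + 2 * w ^ 2) * exp (-w ^ 2) ≤
      (m + 5) * ((1 + ‖x‖ * √S) * exp (-(w ^ 2 / 2))) := by
    have e : exp (-w ^ 2) = exp (-(w ^ 2 / 2)) * exp (-(w ^ 2 / 2)) := by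
      rw [← Real.exp_add]; congr 1; ring
    have h1 : (1 + w ^ 2 / 2) * exp (-(w ^ 2 / 2)) ≤ 1 := by
      rw [Real.exp_neg, ← div_eq_mul_inv, div_le_one (exp_pos _)]
      linarith [Real.add_one_le_exp (w ^ 2 / 2)]
    set E := exp (-(w ^ 2 / 2)) with hE
    have hE0 : 0 < E := exp_pos _
    have hE1 : E ≤ 1 := by nlinarith [sq_nonneg w]
    have hwE : w * E ≤ 1 := by nlinarith [sq_nonneg (w - 1)]
    have hw2E : w ^ 2 * E ≤ 2 := by linarith
    have hx : 0 ≤ ‖x‖ * √S := by positivity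
    have hm : (0 : ℝ) ≤ m := Nat.cast_nonneg m
    rw [e]
    calc _ = ((m + 1) * E + 2 * (‖x‖ * √S) * (w * E) + 2 * (w ^ 2 * E)) * E := by ring
      _ ≤ ((m + 1) * 1 + 2 * (‖x‖ * √S) * 1 + 2 * 2) * E := by gcongr
      _ ≤ ((m + 5) * (1 + ‖x‖ * √S)) * E := by
          gcongr
          nlinarith
      _ = _ := by ring
  rw [hw2, hw3, abs_mul, abs_of_pos (by positivity)]
  calc _ = B * (exp (‖y‖ ^ 2) * (exp (-‖x‖ ^ 2) * (r ^ m * (√S ^ (m + 1))⁻¹ * (t * r *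
          |-((m : ℝ) + 1) / S - 2 * r * inner ℝ x z / S + 2 * r ^ 2 * ‖z‖ ^ 2 / S ^ 2| *
            exp (-w ^ 2))))) := by
        rw [pow_succ r]; ring
    _ ≤ 1 * (exp (‖y‖ ^ 2) * (exp (-‖x‖ ^ 2) * (r ^ m * (√S ^ (m + 1))⁻¹ *
          ((m + 5) * ((1 + ‖x‖ * √S) * exp (-(w ^ 2 / 2))))))) := by
        gcongr ?_ * (_ * (_ * (_ * ?_)))
        exact (mul_le_mul_of_nonneg_right hD (exp_pos _).le).trans hexp
    _ = _ := by ring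

lemma exp_norm_sq_mul_integrable {n : ℕ} {f : EuclideanSpace ℝ (Fin n) → ℝ}
    (hf : Integrable f (gammaM1 n)) :
    AEStronglyMeasurable f volume ∧ Integrable (fun y => exp (‖y‖ ^ 2) * f y) volume := by
  have hw : ∀ y : EuclideanSpace ℝ (Fin n), 0 < π ^ ((n : ℝ) / 2) * exp (‖y‖ ^ 2) := fun y => by
    positivity
  rw [gammaM1, integrable_withDensity_iff_integrable_smul' (by fun_prop)
    (Filter.Eventually.of_forall fun _ => ENNReal.ofReal_lt_top)] at hf
  simp only [ENNReal.toReal_ofReal (hw _).le, smul_eq_mul] at hf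
  constructor
  · have h : Continuous fun y : EuclideanSpace ℝ (Fin n) =>
        (π ^ ((n : ℝ) / 2) * exp (‖y‖ ^ 2))⁻¹ :=
      Continuous.inv₀ (by fun_prop) fun y => (hw y).ne'
    refine (h.aestronglyMeasurable.mul hf.1).congr (Filter.Eventually.of_forall fun y => ?_)
    exact inv_mul_cancel_left₀ (hw y).ne' (f y)
  · refine (hf.const_mul (π ^ ((n : ℝ) / 2))⁻¹).congr (Filter.Eventually.of_forall fun y => ?_)
    have : 0 < π ^ ((n : ℝ) / 2) := by positivity
    simp only
    field_simp

lemma majorant_le {m : ℕ} {r r₀ : ℝ} (hr : 0 < r) (hrr : r ≤ r₀) (hr₀ : r₀ < 1) (x y : Euc m) :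
    majorant r x y ≤ (√(1 - r₀ ^ 2) ^ (m + 1))⁻¹ * (1 + ‖x‖) := by
  have hs₀ := one_sub_sq_pos (hr.trans_le hrr) hr₀
  have hσ₀ : 0 < √(1 - r₀ ^ 2) := Real.sqrt_pos.2 hs₀
  have hσ1 : √(1 - r ^ 2) ≤ 1 := Real.sqrt_le_one.2 (by linarith [sq_nonneg r])
  have hs := one_sub_sq_pos hr (hrr.trans_lt hr₀)
  unfold majorant
  calc _ ≤ 1 * (√(1 - r₀ ^ 2) ^ (m + 1))⁻¹ * (1 + ‖x‖ * 1) * 1 := by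
        gcongr
        · exact pow_le_one₀ hr.le (hrr.trans hr₀.le)
        · exact Real.exp_le_one_iff.2 (neg_nonpos.2 (by positivity))
    _ = _ := by ring

lemma continuous_heatKerA (n : ℕ) (t : ℝ) (x : EuclideanSpace ℝ (Fin n)) :
    Continuous fun y => heatKerA n t x y := by
  unfold heatKerA
  fun_prop

lemma continuous_heatRate {m : ℕ} (t : ℝ) (x : Euc m) : Continuous fun y => heatRate t x y := by
  unfold heatRate
  fun_prop

lemma abs_heatKerA_le {m : ℕ} {t : ℝ} (ht : 0 < t) (x y : Euc m) :
    |heatKerA (m + 1) t x y| ≤ π ^ (-((m + 1 : ℕ) : ℝ) / 2) * (√(1 - exp (-t) ^ 2) ^ (m + 1))⁻¹ *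
      exp (‖y‖ ^ 2) := by
  have hs := one_sub_exp_pos ht
  have hσ : 0 < √(1 - exp (-t) ^ 2) := Real.sqrt_pos.2 hs
  have hr1 : exp (-t) ≤ 1 := Real.exp_le_one_iff.2 (by linarith)
  rw [heatKerA_eq ht, abs_of_pos (by positivity)]
  calc _ ≤ π ^ (-((m + 1 : ℕ) : ℝ) / 2) * exp (‖y‖ ^ 2) * 1 *
        (1 * (√(1 - exp (-t) ^ 2) ^ (m + 1))⁻¹ * 1) := by
        gcongr
        · exact Real.exp_le_one_iff.2 (by simp)
        · exact pow_le_one₀ (exp_pos _).le hr1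
        · exact Real.exp_le_one_iff.2 (neg_nonpos.2 (by positivity))
    _ = _ := by ring

lemma hasDerivAt_integral_heatKerA {m : ℕ} {f : Euc m → ℝ} (hf : AEStronglyMeasurable f volume)
    (hfi : Integrable (fun y => exp (‖y‖ ^ 2) * f y) volume) {t : ℝ} (ht : 0 < t) (x : Euc m) :
    HasDerivAt (fun s => ∫ y, heatKerA (m + 1) s x y * f y)
      (∫ y, heatKerA (m + 1) t x y * heatRate t x y * f y) t := by
  have hK : ∀ s, AEStronglyMeasurable (fun y => heatKerA (m + 1) s x y * f y) volume := fun s =>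
    (continuous_heatKerA _ s x).aestronglyMeasurable.mul hf
  set r₀ := exp (-(t / 2)) with hr₀
  have hr₀1 : r₀ < 1 := by rw [hr₀, Real.exp_lt_one_iff]; linarith
  set B := 2 / t * ((m + 5) * (1 * ((√(1 - r₀ ^ 2) ^ (m + 1))⁻¹ * (1 + ‖x‖)))) with hB
  refine (hasDerivAt_integral_of_dominated_loc_of_deriv_le (μ := volume)
    (F := fun s y => heatKerA (m + 1) s x y * f y)
    (F' := fun s y => heatKerA (m + 1) s x y * heatRate s x y * f y)
    (bound := fun y => B * ‖exp (‖y‖ ^ 2) * f y‖) (s := Set.Ioi (t / 2))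
    (Ioi_mem_nhds (by linarith)) (Filter.Eventually.of_forall hK) ?_ ?_ ?_ ?_ ?_).2
  · refine (hfi.norm.const_mul (π ^ (-((m + 1 : ℕ) : ℝ) / 2) *
      (√(1 - exp (-t) ^ 2) ^ (m + 1))⁻¹)).mono' (hK t) (Filter.Eventually.of_forall fun y => ?_)
    rw [norm_mul, norm_mul, ← mul_assoc, Real.norm_eq_abs, Real.norm_of_nonneg (exp_pos _).le]
    exact mul_le_mul_of_nonneg_right (abs_heatKerA_le ht x y) (norm_nonneg _)
  · exact ((continuous_heatKerA _ t x).mul (continuous_heatRate t x)).aestronglyMeasurable.mul hf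
  · refine Filter.Eventually.of_forall fun y s hs => ?_
    simp only [Set.mem_Ioi] at hs
    have hs0 : 0 < s := by linarith
    rw [norm_mul, norm_mul (exp _), ← mul_assoc, Real.norm_of_nonneg (exp_pos _).le]
    refine mul_le_mul_of_nonneg_right ?_ (norm_nonneg _)
    rw [Real.norm_eq_abs]
    have h := abs_mul_deriv_heatKerA_le hs0 x y
    have hrs : exp (-s) ≤ r₀ := Real.exp_le_exp.2 (by linarith)
    have hm := majorant_le (exp_pos _) hrs hr₀1 x y
    calc |heatKerA (m + 1) s x y * heatRate s x y|
        = s⁻¹ * (s * |heatKerA (m + 1) s x y * heatRate s x y|) := by field_simp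
      _ ≤ s⁻¹ * ((m + 5) * exp (‖y‖ ^ 2) * (exp (-‖x‖ ^ 2) * majorant (exp (-s)) x y)) := by gcongr
      _ ≤ 2 / t * ((m + 5) * exp (‖y‖ ^ 2) *
            (1 * ((√(1 - r₀ ^ 2) ^ (m + 1))⁻¹ * (1 + ‖x‖)))) := by
          have h0 : 0 ≤ majorant (exp (-s)) x y := by
            have := one_sub_exp_pos hs0
            unfold majorant
            positivity
          gcongr
          · rw [inv_eq_one_div, div_le_div_iff₀ hs0 ht]
            linarith
          · exact Real.exp_le_one_iff.2 (by simp)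
      _ = _ := by rw [hB]; ring
  · exact hfi.norm.const_mul B
  · refine Filter.Eventually.of_forall fun y s hs => ?_
    simp only [Set.mem_Ioi] at hs
    exact (hasDerivAt_heatKerA (by linarith) x y).mul_const (f y)

lemma gammaM1_eq (m : ℕ) :
    gammaM1 (m + 1) = ENNReal.ofReal (π ^ (((m + 1 : ℕ) : ℝ) / 2)) • invGauss m := by
  rw [gammaM1, invGauss, ← withDensity_smul _ (by fun_prop)]
  congr 1
  ext x
  rw [Pi.smul_apply, smul_eq_mul, ENNReal.ofReal_mul (by positivity)]

end InverseGaussian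

open InverseGaussian

/-- The maximal operator
`T^𝒜_{*,1}(f)(x) = sup_{t>0} |t ∂_t ∫ T_t^𝒜(x,y) f(y) dy|`
is bounded from `L¹(ℝⁿ, γ₋₁)` into `L^{1,∞}(ℝⁿ, γ₋₁)`. -/
theorem stmt17 (n : ℕ) (hn : 1 ≤ n) :
    ∃ C : ℝ, 0 < C ∧ ∀ f : EuclideanSpace ℝ (Fin n) → ℝ, Integrable f (gammaM1 n) →
      ∀ lam : ℝ, 0 < lam →
      gammaM1 n {x | ENNReal.ofReal lam < ⨆ (t : ℝ) (_ : 0 < t),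
          ENNReal.ofReal
            (t * |deriv (fun s => ∫ y, heatKerA n s x y * f y ∂volume) t|)}
        ≤ ENNReal.ofReal (C / lam) * ∫⁻ y, ENNReal.ofReal |f y| ∂gammaM1 n := by
  obtain ⟨m, rfl⟩ : ∃ m, n = m + 1 := ⟨n - 1, by lia⟩
  obtain ⟨C, hC0, hC⟩ := exists_invGauss_majorant_weak_type m
  refine ⟨C * (m + 5), by positivity, fun f hf lam hlam => ?_⟩
  obtain ⟨hfm, hfi⟩ := exp_norm_sq_mul_integrable hf
  set g : Euc m → ℝ≥0∞ := fun y => ENNReal.ofReal ((m + 5) * |exp (‖y‖ ^ 2) * f y|) with hg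
  have hgm : AEMeasurable g volume := (hfi.1.aemeasurable.abs.const_mul _).ennreal_ofReal
  have hgi : ∫⁻ y, g y ∂volume ≠ ⊤ := by
    have := (hfi.abs.const_mul ((m : ℝ) + 5)).lintegral_lt_top
    exact this.ne
  set ν : Measure (Euc m) := volume.withDensity g with hν
  have : IsFiniteMeasure ν := isFiniteMeasure_withDensity hgi
  have hsub : {x : Euc m | ENNReal.ofReal lam < ⨆ (t : ℝ) (_ : 0 < t),
      ENNReal.ofReal (t * |deriv (fun s => ∫ y, heatKerA (m + 1) s x y * f y ∂volume) t|)} ⊆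
      {x | ∃ r : ℝ, 0 < r ∧ r < 1 ∧
        ENNReal.ofReal lam < ∫⁻ y, ENNReal.ofReal (exp (-‖x‖ ^ 2) * majorant r x y) ∂ν} := by
    intro x hx
    simp only [Set.mem_ofPred_eq, lt_iSup_iff] at hx
    obtain ⟨t, ht, hlt⟩ := hx
    refine ⟨exp (-t), exp_pos _, Real.exp_lt_one_iff.2 (by linarith), hlt.trans_le ?_⟩
    rw [(hasDerivAt_integral_heatKerA hfm hfi ht x).deriv, ← Real.norm_eq_abs,
      ENNReal.ofReal_mul ht.le, ofReal_norm]
    have hmaj : Continuous fun y => exp (-‖x‖ ^ 2) * majorant (exp (-t)) x y := by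
      unfold majorant
      fun_prop
    rw [hν, lintegral_withDensity_eq_lintegral_mul₀ hgm
      hmaj.measurable.ennreal_ofReal.aemeasurable]
    calc _ ≤ ENNReal.ofReal t * ∫⁻ y, ‖heatKerA (m + 1) t x y * heatRate t x y * f y‖ₑ := by
          gcongr
          exact enorm_integral_le_lintegral_enorm _
      _ = ∫⁻ y, ENNReal.ofReal t * ‖heatKerA (m + 1) t x y * heatRate t x y * f y‖ₑ :=
          (lintegral_const_mul' _ _ ENNReal.ofReal_ne_top).symm
      _ ≤ _ := by
          refine lintegral_mono fun y => ?_
          rw [Pi.mul_apply, hg, ← ENNReal.ofReal_mul (by positivity), ← ofReal_norm,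
            ← ENNReal.ofReal_mul ht.le]
          refine ENNReal.ofReal_le_ofReal ?_
          rw [norm_mul, Real.norm_eq_abs, Real.norm_eq_abs, abs_mul (exp _),
            abs_of_pos (exp_pos _), ← mul_assoc]
          calc _ ≤ (m + 5) * exp (‖y‖ ^ 2) * (exp (-‖x‖ ^ 2) * majorant (exp (-t)) x y) * |f y| :=
                mul_le_mul_of_nonneg_right (abs_mul_deriv_heatKerA_le ht x y) (abs_nonneg _)
            _ = _ := by ring
  have hνu : ENNReal.ofReal (π ^ (((m + 1 : ℕ) : ℝ) / 2)) * ν Set.univ =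
      ENNReal.ofReal (m + 5) * ∫⁻ y, ENNReal.ofReal |f y| ∂gammaM1 (m + 1) := by
    rw [hν, withDensity_apply _ MeasurableSet.univ, Measure.restrict_univ, gammaM1,
      lintegral_withDensity_eq_lintegral_mul₀ (by fun_prop)
        hfm.aemeasurable.abs.ennreal_ofReal, ← lintegral_const_mul' _ _ ENNReal.ofReal_ne_top,
      ← lintegral_const_mul' _ _ ENNReal.ofReal_ne_top]
    refine lintegral_congr fun y => ?_
    rw [Pi.mul_apply, hg, ← ENNReal.ofReal_mul (by positivity), ← ENNReal.ofReal_mul (by positivity),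
      ← ENNReal.ofReal_mul (by positivity), abs_mul, abs_of_pos (exp_pos _)]
    congr 1
    ring
  have hl0 : ENNReal.ofReal lam ≠ 0 := (ENNReal.ofReal_pos.2 hlam).ne'
  rw [ENNReal.ofReal_div_of_pos hlam, div_eq_mul_inv, mul_comm _ (ENNReal.ofReal lam)⁻¹, mul_assoc,
    ← ENNReal.mul_le_iff_le_inv hl0 ENNReal.ofReal_ne_top]
  rw [ENNReal.ofReal_mul hC0.le, mul_assoc, ← hνu, gammaM1_eq, Measure.smul_apply, smul_eq_mul]
  calc _ = ENNReal.ofReal (π ^ (((m + 1 : ℕ) : ℝ) / 2)) * (ENNReal.ofReal lam * invGauss m _) := by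
        ring
    _ ≤ ENNReal.ofReal (π ^ (((m + 1 : ℕ) : ℝ) / 2)) * (ENNReal.ofReal C * ν Set.univ) := by
        refine mul_le_mul_right ?_ _
        exact (mul_le_mul_right (measure_mono hsub) _).trans (hC ν _)
    _ = _ := by ring
end
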